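/- Let p be a prime and q = p^n a prime power. The group PSL(2, q) is a Hurwitz group (i.e., there exists a surjective group homomorphism from the (2,3,7) triangle group Δ(2,3,7) onto PSL(2, q)) if and only if one of the following holds: (i) q = 7; (ii) n = 1 and p ≡ 1 or p ≡ -1 (mod 7); (iii) n = 3 and p ≡ 2, 3, 4, or 5 (mod 7) (equivalently, p is congruent to ±2 or ±3 mod 7). -/

import Mathlib

open scoped MatrixGroups

/-- The set of relators of the (2,3,7) triangle group
`⟨x, y | x² = y³ = (x*y)⁷ = 1⟩` inside the free group on two generators. -/
def triangleRels237 : Set (FreeGroup (Fin 2)) :=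
  {FreeGroup.of 0 ^ 2, FreeGroup.of 1 ^ 3, (FreeGroup.of 0 * FreeGroup.of 1) ^ 7}

/-- The (2,3,7) triangle group `Δ(2,3,7) = ⟨x, y | x² = y³ = (x*y)⁷ = 1⟩`. -/
abbrev TriangleGroup237 : Type := PresentedGroup triangleRels237

theorem eq_two_or_mul_eq_succ_of_class_equation {Q m j a N : ℕ} (hQ : 2 ≤ Q) (hj : m * j = Q - 1)
    (hN : Q + 1 ≤ N) (ha : 7 ≤ a) (h : (Q - 2) * a * N + 2 * a = N * Q * m) :
    (Q = 2 ∧ m = 1 ∧ N = a) ∨ j * a = Q + 1 := by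
  obtain ⟨r, rfl⟩ := Nat.exists_eq_add_of_le hQ
  have e1 : 2 + r - 2 = r := by omega
  have e2 : 2 + r - 1 = r + 1 := by omega
  rw [e1] at h
  rw [e2] at hj
  rcases Nat.eq_zero_or_pos r with rfl | hr
  · left
    have hm : m = 1 := Nat.eq_one_of_mul_eq_one_right (by simpa using hj)
    subst hm
    refine ⟨rfl, rfl, ?_⟩
    omega
  · right
    have hj0 : 1 ≤ j := by
      rcases Nat.eq_zero_or_pos j with rfl | h0
      · omega
      · exact h0
    have hb7 : 7 ≤ j * a := by nlinarith
    have key : (j * a) * (r * N + 2) = N * (2 + r) * (r + 1) := by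
      rw [← hj]; linear_combination j * h
    generalize j * a = b at *
    rcases lt_trichotomy b (2 + r + 1) with hlt | heq | hgt
    · exfalso
      have : b ≤ r + 2 := by omega
      have h1 : b * (r * N + 2) ≤ (r + 2) * (r * N + 2) := Nat.mul_le_mul_right _ this
      have h2 : (r + 2) * (N * (r + 1)) ≤ (r + 2) * (r * N + 2) := by nlinarith
      have h3 := Nat.le_of_mul_le_mul_left h2 (by omega)
      nlinarith
    · exact heq
    · exfalso
      rcases Nat.lt_or_ge r 2 with h1 | h1
      · have : r = 1 := by omega
        subst this
        nlinarith
      · have h1 : (r + 4) * (r * N + 2) ≤ b * (r * N + 2) := Nat.mul_le_mul_right _ (by omega)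
        nlinarith

theorem exists_seven_dvd_of_class_equation {I : Type*} [Fintype I] [DecidableEq I]
    (S Q N : I → ℕ) (h : ℕ) (hS : ∀ i, 1 ≤ S i) (hQ : ∀ i, 1 ≤ Q i) (hQS : ∀ i, Q i ∣ S i)
    (hsum : ∑ i, ((S i + Q i - 2 : ℚ) / S i) = 2 - 2 / h)
    (hm : ∀ i, Q i ≠ 1 → S i / Q i ∣ Q i - 1) (hNS : ∀ i, N i * S i = h)
    (hN : ∀ i, Q i ≠ 1 → Q i + 1 ≤ N i) (hN0 : ∀ i, 3 ≤ N i)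
    (y : I) (h7 : 7 ∣ S y) :
    ∃ i, Q i ≠ 1 ∧ (7 ∣ Q i ∨ 7 ∣ Q i - 1 ∨ 7 ∣ Q i + 1) := by
  have p7 : Nat.Prime 7 := by norm_num
  by_cases hy : Q y = 1
  swap
  · refine ⟨y, hy, ?_⟩
    have : S y = Q y * (S y / Q y) := (Nat.mul_div_cancel' (hQS y)).symm
    rw [this] at h7
    rcases p7.dvd_mul.1 h7 with h | h
    · exact Or.inl h
    · exact Or.inr (Or.inl (h.trans (hm y hy)))
  set w : I → ℚ := fun i => ((S i + Q i - 2 : ℚ) / S i) with hw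
  have hSq : ∀ i, (1 : ℚ) ≤ S i := fun i => by exact_mod_cast hS i
  have hQq : ∀ i, (1 : ℚ) ≤ Q i := fun i => by exact_mod_cast hQ i
  have hw0 : ∀ i, 0 ≤ w i := fun i =>
    div_nonneg (by linarith [hSq i, hQq i]) (by linarith [hSq i])
  have hwhalf : ∀ i, w i ≠ 0 → 1 / 2 ≤ w i := by
    intro i hi
    rw [hw]; simp only
    rw [le_div_iff₀ (by linarith [hSq i])]
    rcases Nat.lt_or_ge (S i) 2 with h1 | h1
    · have h2 : S i = 1 := by have := hS i; omega
      have h3 : Q i = 1 := by have := hQS i; rw [h2] at this; exact Nat.dvd_one.1 this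
      exact absurd (by rw [hw]; simp [h2, h3]; norm_num) hi
    · have : (2 : ℚ) ≤ S i := by exact_mod_cast h1
      linarith [hQq i]
  have ha7 : 7 ≤ S y := Nat.le_of_dvd (hS y) h7
  have ha7q : (7 : ℚ) ≤ S y := by exact_mod_cast ha7
  have hwy : w y = 1 - 1 / S y := by
    rw [hw]; simp only [hy]; field_simp; push_cast; ring
  have hayinv : (1 : ℚ) / S y ≤ 1 / 7 := one_div_le_one_div_of_le (by norm_num) ha7q
  have hhy : (h : ℚ) = N y * S y := by exact_mod_cast (hNS y).symm
  have hNyq : (3 : ℚ) ≤ N y := by exact_mod_cast hN0 y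
  have hh0 : (0 : ℚ) < h := by rw [hhy]; positivity
  have hsplit : w y + ∑ i ∈ Finset.univ.erase y, w i = 2 - 2 / h := by
    rw [Finset.add_sum_erase _ _ (Finset.mem_univ y)]; exact hsum
  have h2h : (0 : ℚ) < 2 / h := by positivity
  by_cases hex : ∃ x, Q x ≠ 1
  · obtain ⟨x, hx⟩ := hex
    have hxy : x ≠ y := by rintro rfl; exact hx hy
    have hsplit2 : w x + ∑ i ∈ (Finset.univ.erase y).erase x, w i
        = ∑ i ∈ Finset.univ.erase y, w i :=
      Finset.add_sum_erase _ _ (Finset.mem_erase.2 ⟨hxy, Finset.mem_univ x⟩)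
    have hQ2 : 2 ≤ Q x := by have := hQ x; omega
    have hQ2q : (2 : ℚ) ≤ Q x := by exact_mod_cast hQ2
    have hwx : w x = 1 + (Q x - 2) / S x := by
      have := hSq x
      rw [hw]; simp only; field_simp; ring
    have hwx1 : 1 ≤ w x := by
      rw [hwx]
      have : (0 : ℚ) ≤ (Q x - 2) / S x := div_nonneg (by linarith) (by linarith [hSq x])
      linarith
    have hR : ∑ i ∈ (Finset.univ.erase y).erase x, w i = 0 := by
      refine Finset.sum_eq_zero fun z hz => ?_
      by_contra hzne
      have h1 := hwhalf z hzne
      have h2 := Finset.single_le_sum (f := w) (fun i _ => hw0 i) hz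
      linarith
    obtain ⟨m, hmS⟩ := hQS x
    have hm' : m ∣ Q x - 1 := by
      have := hm x hx
      rwa [hmS, Nat.mul_div_cancel_left _ (by omega)] at this
    obtain ⟨j, hj⟩ := hm'
    have heq : (Q x - 2) * S y * N x + 2 * S y = N x * Q x * m := by
      have hhx : (h : ℚ) = N x * S x := by exact_mod_cast (hNS x).symm
      have h1 : 1 + (Q x - 2 : ℚ) / S x + (1 - 1 / S y) = 2 - 2 / h := by
        rw [← hwx, ← hwy]; linarith
      have hNx : (3 : ℚ) ≤ N x := by exact_mod_cast hN0 x
      have hSx := hSq x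
      rw [hhx] at h1
      have h2 : (Q x - 2 : ℚ) * S y * N x + 2 * S y = N x * S x := by
        field_simp at h1
        linear_combination h1
      rw [hmS] at h2
      have h3 : ((Q x - 2 : ℕ) : ℚ) = Q x - 2 := by push_cast [hQ2]; ring
      rw [← h3] at h2
      rw [mul_assoc (N x)]
      exact_mod_cast h2
    rcases eq_two_or_mul_eq_succ_of_class_equation hQ2 hj.symm (hN x hx) ha7 heq with
      ⟨hQx, hmx, hNx⟩ | hb
    · exfalso
      have h1 := hNS x
      have h2 := hNS y
      rw [hmS, hQx, hmx, hNx] at h1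
      have := hN0 y
      nlinarith
    · exact ⟨x, hx, Or.inr (Or.inr (hb ▸ Dvd.dvd.mul_left h7 j))⟩
  · exfalso
    push Not at hex
    have hwi : ∀ i, w i = 1 - 1 / S i := by
      intro i
      have := hSq i
      rw [hw]; simp only [hex i]; field_simp; push_cast; ring
    have hwlt : ∀ i, w i < 1 := by
      intro i
      have := hSq i
      rw [hwi]
      have : (0 : ℚ) < 1 / S i := by positivity
      linarith
    have hwval : ∀ i, w i ≠ 0 → w i = 1 / 2 ∨ 2 / 3 ≤ w i := by
      intro i hi
      rw [hwi] at hi ⊢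
      rcases Nat.lt_or_ge (S i) 3 with h1 | h1
      · left
        have h2 : S i = 1 ∨ S i = 2 := by have := hS i; omega
        rcases h2 with h2 | h2
        · rw [h2] at hi; norm_num at hi
        · rw [h2]; norm_num
      · right
        have : (1 : ℚ) / S i ≤ 1 / 3 := one_div_le_one_div_of_le (by norm_num) (by exact_mod_cast h1)
        linarith
    have h2h' : 2 / (h : ℚ) ≤ 2 / 3 * (1 / S y) := by
      rw [hhy, div_le_iff₀ (by positivity)]
      field_simp
      linarith
    have hSyinv : (0 : ℚ) < 1 / S y := by positivity
    set s := Finset.univ.erase y with hs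
    have hR1 : 1 < ∑ i ∈ s, w i := by linarith
    have hR2 : ∑ i ∈ s, w i < 7 / 6 := by linarith
    have hne : ∑ i ∈ s, w i ≠ 0 := by linarith
    obtain ⟨u, hu, hu0⟩ := Finset.exists_ne_zero_of_sum_ne_zero hne
    have hsu := Finset.add_sum_erase s w hu
    have hne2 : ∑ i ∈ s.erase u, w i ≠ 0 := by linarith [hwlt u]
    obtain ⟨v, hv, hv0⟩ := Finset.exists_ne_zero_of_sum_ne_zero hne2
    have hsv := Finset.add_sum_erase (s.erase u) w hv
    have hrest : 0 ≤ ∑ i ∈ (s.erase u).erase v, w i := Finset.sum_nonneg fun i _ => hw0 i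
    rcases hwval u hu0 with hu1 | hu1
    · rcases hwval v hv0 with hv1 | hv1
      · have hne3 : ∑ i ∈ (s.erase u).erase v, w i ≠ 0 := by linarith
        obtain ⟨t, ht, ht0⟩ := Finset.exists_ne_zero_of_sum_ne_zero hne3
        have h1 := hwhalf t ht0
        have h2 := Finset.single_le_sum (f := w) (fun i _ => hw0 i) ht
        linarith
      · linarith
    · have := hwhalf v hv0
      linarith

open MulAction in
theorem card_div_card_dvd_card_sub_one {H : Type*} [Group H] [Finite H] {S V : Subgroup H}
    (hVS : V ≤ S) (hnorm : ∀ s ∈ S, ∀ v ∈ V, s * v * s⁻¹ ∈ V)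
    (hcent : ∀ v ∈ V, v ≠ 1 → ∀ s ∈ S, s * v = v * s ↔ s ∈ V) :
    Nat.card S / Nat.card V ∣ Nat.card V - 1 := by
  classical
  have := Fintype.ofFinite H
  let X := {v : H // v ∈ V ∧ v ≠ 1}
  let act : MulAction S X :=
    { smul := fun s v => ⟨s * v.1 * (s : H)⁻¹, hnorm s s.2 v v.2.1, by
        simpa using v.2.2⟩
      one_smul := fun v => Subtype.ext (by change (1 : H) * v.1 * (1 : H)⁻¹ = v.1; simp)
      mul_smul := fun s t v => Subtype.ext (by
        change (s * t : H) * v.1 * (s * t : H)⁻¹ = s * (t * v.1 * (t : H)⁻¹) * (s : H)⁻¹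
        group) }
  have hcardX : Nat.card X = Nat.card V - 1 := by
    have e : X ≃ {v : V // v ≠ 1} :=
      { toFun := fun v => ⟨⟨v.1, v.2.1⟩, fun h => v.2.2 (congrArg Subtype.val h)⟩
        invFun := fun v => ⟨v.1.1, v.1.2, fun h => v.2 (Subtype.ext h)⟩
        left_inv := fun _ => rfl
        right_inv := fun _ => rfl }
    rw [Nat.card_congr e, Nat.card_eq_fintype_card, Nat.card_eq_fintype_card,
      Fintype.card_subtype_compl, Fintype.card_subtype_eq]
  have hstab : ∀ v : X, Nat.card (stabilizer S v) = Nat.card V := by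
    intro v
    have e : stabilizer S v = V.subgroupOf S := by
      ext s
      rw [mem_stabilizer_iff, Subgroup.mem_subgroupOf, ← hcent v v.2.1 v.2.2 s s.2,
        ← mul_inv_eq_iff_eq_mul]
      exact Subtype.ext_iff
    rw [e]
    exact Nat.card_congr (Subgroup.subgroupOfEquivOfLe hVS).toEquiv
  have horb : ∀ v : X, Nat.card (orbit S v) = Nat.card S / Nat.card V := by
    intro v
    have := card_orbit_mul_card_stabilizer_eq_card_group S v
    rw [← Nat.card_eq_fintype_card, ← Nat.card_eq_fintype_card, ← Nat.card_eq_fintype_card,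
      hstab] at this
    exact (Nat.div_eq_of_eq_mul_left Nat.card_pos this.symm).symm
  rw [← hcardX, Nat.card_congr (selfEquivSigmaOrbits S X), Nat.card_sigma]
  exact Finset.dvd_sum fun ω _ => by rw [horb]

open MulAction Pointwise in
theorem exists_seven_dvd_of_fixedBy {H Ω : Type*} [Group H] [Finite H] [Finite Ω] [MulAction H Ω]
    (hfix : ∀ g : H, g ≠ 1 → ∃ x y : Ω, fixedBy Ω g = {x, y})
    (V : Ω → Subgroup H) (hV : ∀ x g, g ∈ V x ↔ g = 1 ∨ fixedBy Ω g = {x})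
    (hcomm : ∀ x, ∀ g ∈ V x, ∀ g' ∈ V x, g * g' = g' * g)
    (hglob : ∀ x : Ω, ∃ g : H, g • x ≠ x) (hidx : ∀ K : Subgroup H, K.index ≠ 2)
    {r : H} (hr : orderOf r = 7) :
    ∃ x, Nat.card (V x) ≠ 1 ∧
      (7 ∣ Nat.card (V x) ∨ 7 ∣ Nat.card (V x) - 1 ∨ 7 ∣ Nat.card (V x) + 1) := by
  classical
  have := Fintype.ofFinite H
  have := Fintype.ofFinite Ω
  have hfixone : ∀ (g : H) (x : Ω), g ≠ 1 → fixedBy Ω g = {x} → g • x = x := by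
    intro g x _ h
    have : x ∈ fixedBy Ω g := by rw [h]; rfl
    exact this
  have hVS : ∀ x, V x ≤ stabilizer H x := by
    intro x g hg
    rw [mem_stabilizer_iff]
    by_cases h1 : g = 1
    · rw [h1, one_smul]
    · exact hfixone g x h1 (((hV x g).1 hg).resolve_left h1)
  have hfixconj : ∀ (s g : H), fixedBy Ω (s * g * s⁻¹) = s • fixedBy Ω g := by
    intro s g
    exact (smul_fixedBy Ω g s).symm
  have hVconj : ∀ (s : H) (x : Ω) (g : H), s * g * s⁻¹ ∈ V (s • x) ↔ g ∈ V x := by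
    intro s x g
    rw [hV, hV, hfixconj, conj_eq_one_iff, ← Set.smul_set_singleton, smul_left_cancel_iff]
  have hVcard : ∀ (s : H) (x : Ω), Nat.card (V (s • x)) = Nat.card (V x) := by
    intro s x
    symm
    refine Nat.card_congr ((MulAut.conj s).toEquiv.subtypeEquiv fun g => ?_)
    exact (hVconj s x g).symm
  have horbne : ∀ x : Ω, Nonempty (orbit H x) := fun x => ⟨⟨x, mem_orbit_self x⟩⟩
  have horbst : ∀ x : Ω, Nat.card (orbit H x) * Nat.card (stabilizer H x) = Nat.card H := by
    intro x
    simpa only [Nat.card_eq_fintype_card] using card_orbit_mul_card_stabilizer_eq_card_group H x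
  have hScard : ∀ (s : H) (x : Ω),
      Nat.card (stabilizer H (s • x)) = Nat.card (stabilizer H x) := by
    intro s x
    have h1 := horbst (s • x)
    rw [orbit_smul, ← horbst x] at h1
    have : 0 < Nat.card (orbit H x) := Nat.card_pos
    exact Nat.eq_of_mul_eq_mul_left this h1
  -- double counting of pairs (nontrivial element, fixed point), parabolic ones weighted twice
  have hdouble : ∑ x : Ω, ((Nat.card (stabilizer H x) : ℚ) + Nat.card (V x) - 2)
      = 2 * Nat.card H - 2 := by
    have hx : ∀ x : Ω, ((Nat.card (stabilizer H x) : ℚ) + Nat.card (V x) - 2)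
        = ∑ g ∈ Finset.univ.erase (1 : H),
          ((if g • x = x then (1 : ℚ) else 0) + if fixedBy Ω g = {x} then 1 else 0) := by
      intro x
      have h1 : (Nat.card (stabilizer H x) : ℚ) = ∑ g : H, if g • x = x then (1 : ℚ) else 0 := by
        rw [Finset.sum_boole, Nat.card_eq_fintype_card, Fintype.card_subtype]
        rfl
      have h2 : (Nat.card (V x) : ℚ) = ∑ g : H, if g ∈ V x then (1 : ℚ) else 0 := by
        rw [Finset.sum_boole, Nat.card_eq_fintype_card, Fintype.card_subtype]
      rw [← Finset.add_sum_erase _ _ (Finset.mem_univ (1 : H))] at h1 h2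
      rw [h1, h2, Finset.sum_add_distrib]
      have h3 : ∑ g ∈ Finset.univ.erase (1 : H), (if g ∈ V x then (1 : ℚ) else 0)
          = ∑ g ∈ Finset.univ.erase (1 : H), (if fixedBy Ω g = {x} then (1 : ℚ) else 0) := by
        refine Finset.sum_congr rfl fun g hg => ?_
        have := Finset.ne_of_mem_erase hg
        simp [hV, this]
      rw [h3, if_pos (one_smul H x), if_pos (one_mem (V x))]
      ring
    rw [Finset.sum_congr rfl fun x _ => hx x, Finset.sum_comm]
    have hg : ∀ g ∈ Finset.univ.erase (1 : H), ∑ x : Ω,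
        ((if g • x = x then (1 : ℚ) else 0) + if fixedBy Ω g = {x} then 1 else 0) = 2 := by
      intro g hg
      obtain ⟨u, v, huv⟩ := hfix g (Finset.ne_of_mem_erase hg)
      have hmem : ∀ x, g • x = x ↔ x = u ∨ x = v := by
        intro x
        have : x ∈ fixedBy Ω g ↔ x ∈ ({u, v} : Set Ω) := by rw [huv]
        simpa using this
      rw [Finset.sum_add_distrib]
      simp only [hmem, huv]
      by_cases h : u = v
      · subst h
        simp only [or_self, Set.pair_eq_singleton, Set.singleton_eq_singleton_iff, eq_comm (a := u)]
        simp
        norm_num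
      · have h1 : ∀ x, ({u, v} : Set Ω) ≠ {x} := by
          intro x hx
          have hu : u ∈ ({x} : Set Ω) := hx ▸ Set.mem_insert u {v}
          have hv : v ∈ ({x} : Set Ω) := hx ▸ Set.mem_insert_of_mem u rfl
          exact h (hu.trans hv.symm)
        simp only [h1, if_false, Finset.sum_const_zero, add_zero, Finset.sum_boole]
        have : (Finset.univ.filter fun x => x = u ∨ x = v) = {u, v} := by ext; simp
        rw [this, Finset.card_pair h]
        norm_num
    rw [Finset.sum_congr rfl hg, Finset.sum_const, Finset.card_erase_of_mem (Finset.mem_univ _),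
      Finset.card_univ, ← Nat.card_eq_fintype_card, nsmul_eq_mul, Nat.cast_pred Nat.card_pos]
    ring
  have hH0 : (0 : ℚ) < Nat.card H := by exact_mod_cast Nat.card_pos
  have hquot : ∑ ω : orbitRel.Quotient H Ω,
      ((Nat.card (stabilizer H ω.out) : ℚ) + Nat.card (V ω.out) - 2) /
        Nat.card (stabilizer H ω.out) = 2 - 2 / Nat.card H := by
    have h1 : ∀ x : Ω, ∃ s : H, s • (Quotient.mk (orbitRel H Ω) x).out = x := fun x =>
      (orbitRel_apply.1 ((orbitRel H Ω).symm (Quotient.mk_out (s := orbitRel H Ω) x)))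
    have h2 : ∑ x : Ω, ((Nat.card (stabilizer H x) : ℚ) + Nat.card (V x) - 2)
        = ∑ ω : orbitRel.Quotient H Ω, ∑ x : Ω with Quotient.mk (orbitRel H Ω) x = ω,
          ((Nat.card (stabilizer H x) : ℚ) + Nat.card (V x) - 2) :=
      (Finset.sum_fiberwise _ _ _).symm
    have h3 : ∀ ω : orbitRel.Quotient H Ω, ∑ x : Ω with Quotient.mk (orbitRel H Ω) x = ω,
          ((Nat.card (stabilizer H x) : ℚ) + Nat.card (V x) - 2)
        = Nat.card H * (((Nat.card (stabilizer H ω.out) : ℚ) + Nat.card (V ω.out) - 2) /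
        Nat.card (stabilizer H ω.out)) := by
      intro ω
      have h4 : ∀ x ∈ (Finset.univ.filter fun x => Quotient.mk (orbitRel H Ω) x = ω),
          ((Nat.card (stabilizer H x) : ℚ) + Nat.card (V x) - 2)
            = ((Nat.card (stabilizer H ω.out) : ℚ) + Nat.card (V ω.out) - 2) := by
        intro x hx
        obtain ⟨s, hs⟩ := h1 x
        rw [(Finset.mem_filter.1 hx).2] at hs
        rw [← hs, hScard, hVcard]
      rw [Finset.sum_congr rfl h4, Finset.sum_const, nsmul_eq_mul]
      have h5 : (Finset.univ.filter fun x => Quotient.mk (orbitRel H Ω) x = ω).card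
          = Nat.card (orbit H ω.out) := by
        rw [Nat.card_eq_fintype_card, Fintype.card_subtype]
        congr 1
        ext x
        simp only [Finset.mem_filter, Finset.mem_univ, true_and]
        rw [← orbitRel_apply (G := H)]
        constructor
        · rintro rfl
          exact (orbitRel H Ω).symm (Quotient.mk_out (s := orbitRel H Ω) x)
        · intro h
          rw [← Quotient.out_eq ω]
          exact Quotient.sound h
      have h6 : (Nat.card (orbit H ω.out) : ℚ) * Nat.card (stabilizer H ω.out) = Nat.card H := by
        exact_mod_cast horbst ω.out
      have h7 : (Nat.card (stabilizer H ω.out) : ℚ) ≠ 0 := by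
        exact_mod_cast Nat.card_pos.ne'
      rw [h5, ← h6]
      field_simp
    rw [h2, Finset.sum_congr rfl fun ω _ => h3 ω, ← Finset.mul_sum] at hdouble
    rw [eq_sub_iff_add_eq]
    field_simp
    linarith
  have hmoved : ∀ x : Ω, Nat.card (V x) ≠ 1 → Nat.card (V x) + 1 ≤ Nat.card (orbit H x) := by
    intro x _
    obtain ⟨s, hs⟩ := hglob x
    let f : Option (V x) → orbit H x := fun o =>
      o.elim ⟨x, mem_orbit_self x⟩ fun v => ⟨v.1 • s • x, by rw [smul_smul]; exact mem_orbit x _⟩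
    have hvx : ∀ v : V x, v.1 • x = x := fun v => hVS x v.2
    have hf : Function.Injective f := by
      have hno : ∀ v : V x, v.1 • s • x ≠ x := by
        intro v hv
        apply hs
        have : v.1 • s • x = v.1 • x := by rw [hv, hvx]
        exact smul_left_cancel _ this
      rintro (_ | v) (_ | w) h
      · rfl
      · exact absurd (congrArg Subtype.val h).symm (hno w)
      · exact absurd (congrArg Subtype.val h) (hno v)
      · have h1 : v.1 • s • x = w.1 • s • x := congrArg Subtype.val h
        have h2 : w.1⁻¹ * v.1 ∈ V x := mul_mem (inv_mem w.2) v.2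
        have h3 : s • x ∈ fixedBy Ω (w.1⁻¹ * v.1) := by
          rw [mem_fixedBy, mul_smul, h1, inv_smul_smul]
        rcases (hV x _).1 h2 with h4 | h4
        · congr 1
          exact Subtype.ext (inv_mul_eq_one.1 h4).symm
        · rw [h4] at h3
          exact absurd h3 hs
    have := Nat.card_le_card_of_injective f hf
    rwa [Nat.card_eq_fintype_card, Fintype.card_option, ← Nat.card_eq_fintype_card] at this
  have hthree : ∀ x : Ω, 3 ≤ Nat.card (orbit H x) := by
    intro x
    have h0 : (stabilizer H x).index = Nat.card (orbit H x) := by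
      rw [index_stabilizer]; rfl
    have h1 : Nat.card (orbit H x) ≠ 2 := h0 ▸ hidx _
    have h2 : Nat.card (orbit H x) ≠ 1 := by
      rw [← h0, Ne, Subgroup.index_eq_one]
      intro h
      obtain ⟨s, hs⟩ := hglob x
      exact hs (mem_stabilizer_iff.1 (h ▸ Subgroup.mem_top s))
    have h3 : 0 < Nat.card (orbit H x) := Nat.card_pos
    omega
  have hdvd : ∀ x : Ω, Nat.card (V x) ≠ 1 →
      Nat.card (stabilizer H x) / Nat.card (V x) ∣ Nat.card (V x) - 1 := by
    intro x _
    refine card_div_card_dvd_card_sub_one (hVS x) ?_ ?_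
    · intro s hs v hv
      have := (hVconj s x v).2 hv
      rwa [mem_stabilizer_iff.1 hs] at this
    · intro v hv hv1 s hs
      refine ⟨fun h => ?_, fun h => hcomm x s h v hv⟩
      rw [hV]
      by_contra! hcon
      obtain ⟨hs1, hs2⟩ := hcon
      have hvfix : fixedBy Ω v = {x} := ((hV x v).1 hv).resolve_left hv1
      apply hs2
      have hsv : s * v * s⁻¹ = v := by rw [h]; group
      have hvs : v * s * v⁻¹ = s := by rw [← h]; group
      have hstable : v • fixedBy Ω s = fixedBy Ω s := by rw [← hfixconj, hvs]
      obtain ⟨a, b, hab⟩ := hfix s hs1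
      have hx : x ∈ fixedBy Ω s := hs
      have key : ∀ z, z ∈ fixedBy Ω s → z = x := by
        intro z hz
        by_contra hzx
        have hzv : v • z ∈ fixedBy Ω s := hstable ▸ Set.smul_mem_smul_set hz
        have hvz : v • z ≠ z := fun h => hzx (by
          have : z ∈ fixedBy Ω v := h
          rwa [hvfix] at this)
        have hvx : v • x = x := hVS x hv
        have hvz2 : v • z ≠ x := fun h => hzx (smul_left_cancel v (h.trans hvx.symm))
        rw [hab] at hx hz hzv
        simp only [Set.mem_insert_iff, Set.mem_singleton_iff] at hx hz hzv
        grind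
      exact Set.eq_singleton_iff_unique_mem.2 ⟨hx, key⟩
  have hr1 : r ≠ 1 := by
    rintro rfl
    simp at hr
  obtain ⟨y, y', hy⟩ := hfix r hr1
  have hy' : r • y = y := by
    have : y ∈ fixedBy Ω r := by rw [hy]; simp
    exact this
  have h7y : 7 ∣ Nat.card (stabilizer H y) := by
    rw [← hr, ← Subgroup.orderOf_mk r (mem_stabilizer_iff.2 hy')]
    exact orderOf_dvd_natCard _
  obtain ⟨s, hs⟩ : ∃ s : H, s • y = (Quotient.mk (orbitRel H Ω) y).out :=
    orbitRel_apply.1 (Quotient.mk_out (s := orbitRel H Ω) y)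
  obtain ⟨ω, hω⟩ := exists_seven_dvd_of_class_equation (I := orbitRel.Quotient H Ω)
    (fun ω => Nat.card (stabilizer H ω.out)) (fun ω => Nat.card (V ω.out))
    (fun ω => Nat.card (orbit H ω.out)) (Nat.card H) (fun _ => Nat.card_pos)
    (fun _ => Nat.card_pos) (fun ω => Subgroup.card_dvd_of_le (hVS _)) hquot
    (fun ω => hdvd _) (fun ω => horbst _) (fun ω => hmoved _) (fun ω => hthree _)
    (Quotient.mk (orbitRel H Ω) y) (by
      rw [← hs, hScard]; exact h7y)
  exact ⟨ω.out, hω⟩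

section Mobius

variable {F : Type*} [Field F]

theorem mem_of_neg_mem {G : Subgroup SL(2, F)} (hneg : -1 ∈ G) {g : SL(2, F)} (h : -g ∈ G) :
    g ∈ G := by
  simpa using mul_mem hneg h

theorem det_entries (g : SL(2, F)) : g 0 0 * g 1 1 - g 0 1 * g 1 0 = 1 := by
  rw [← Matrix.det_fin_two]; exact g.2

theorem mul_entry (g h : SL(2, F)) (i j : Fin 2) :
    (g * h) i j = g i 0 * h 0 j + g i 1 * h 1 j := by
  rw [Matrix.SpecialLinearGroup.coe_mul, Matrix.mul_apply, Fin.sum_univ_two]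

theorem ext_entries {g h : SL(2, F)} (h00 : g 0 0 = h 0 0) (h01 : g 0 1 = h 0 1)
    (h10 : g 1 0 = h 1 0) (h11 : g 1 1 = h 1 1) : g = h := by
  ext i j; fin_cases i <;> fin_cases j <;> assumption

/-- The element of `SL(2, F)` with the given entries. -/
def sl2 (a b c d : F) (h : a * d - b * c = 1) : SL(2, F) :=
  ⟨!![a, b; c, d], by rw [Matrix.det_fin_two_of]; exact h⟩

section entries

variable (a b c d : F) (h : a * d - b * c = 1)

@[simp] theorem sl2_zero_zero : sl2 a b c d h 0 0 = a := rfl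

@[simp] theorem sl2_zero_one : sl2 a b c d h 0 1 = b := rfl

@[simp] theorem sl2_one_zero : sl2 a b c d h 1 0 = c := rfl

@[simp] theorem sl2_one_one : sl2 a b c d h 1 1 = d := rfl

end entries

/-- The one-parameter group `s ↦ 1 + s • N` attached to the nilpotent matrix `N = !![α, β; γ, -α]`. -/
def unipotentHom (α β γ : F) (h : α * α + β * γ = 0) : Multiplicative F →* SL(2, F) where
  toFun s := sl2 (1 + s.toAdd * α) (s.toAdd * β) (s.toAdd * γ) (1 - s.toAdd * α) (by
    linear_combination (-s.toAdd ^ 2) * h)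
  map_one' := by
    apply ext_entries <;> simp
  map_mul' s t := by
    apply ext_entries <;> simp only [mul_entry, toAdd_mul, sl2_zero_zero, sl2_zero_one,
      sl2_one_zero, sl2_one_one]
    · linear_combination (-s.toAdd * t.toAdd) * h
    · ring
    · ring
    · linear_combination (-s.toAdd * t.toAdd) * h

theorem eq_top_of_upper_mem {G : Subgroup SL(2, F)}
    (hU : ∀ t : F, sl2 1 t 0 1 (by simp) ∈ G)
    {g : SL(2, F)} (hg : g ∈ G) (hg0 : g 1 0 ≠ 0) : G = ⊤ := by
  let W (c : F) (hc : c ≠ 0) : SL(2, F) := sl2 0 (-c⁻¹) c 0 (by simp [hc])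
  have hW : W (g 1 0) hg0 ∈ G := by
    have e : sl2 1 (g 0 0 / g 1 0) 0 1 (by simp) * W (g 1 0) hg0 *
        sl2 1 (g 1 1 / g 1 0) 0 1 (by simp) = g := by
      have := det_entries g
      apply ext_entries <;> simp [W, mul_entry] <;> field_simp
      linear_combination this
    rw [← e] at hg
    rwa [Subgroup.mul_mem_cancel_right _ (hU _), Subgroup.mul_mem_cancel_left _ (hU _)] at hg
  have hL : ∀ t : F, sl2 1 0 t 1 (by simp) ∈ G := by
    intro t
    have e : sl2 1 0 t 1 (by simp) = W (g 1 0) hg0 *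
        sl2 1 (-t / (g 1 0) ^ 2) 0 1 (by simp) * (W (g 1 0) hg0)⁻¹ := by
      rw [eq_mul_inv_iff_mul_eq]
      apply ext_entries <;> simp [W, mul_entry] <;> field_simp
    rw [e]
    exact mul_mem (mul_mem hW (hU _)) (inv_mem hW)
  have hbig : ∀ k : SL(2, F), k 1 0 ≠ 0 → k ∈ G := by
    intro k h0
    have e : k = sl2 1 ((k 0 0 - 1) / k 1 0) 0 1 (by simp) *
        sl2 1 0 (k 1 0) 1 (by simp) * sl2 1 ((k 1 1 - 1) / k 1 0) 0 1 (by simp) := by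
      have := det_entries k
      apply ext_entries <;> simp [mul_entry] <;> field_simp
      · ring
      · linear_combination -this
      · ring
    rw [e]
    exact mul_mem (mul_mem (hU _) (hL _)) (hU _)
  rw [eq_top_iff]
  intro k _
  by_cases h0 : k 1 0 = 0
  · have h1 : k * sl2 1 0 1 1 (by simp) ∈ G := by
      apply hbig
      have := det_entries k
      intro h2
      simp [mul_entry, h0] at h2
      simp [h0, h2] at this
    exact (Subgroup.mul_mem_cancel_right _ (hL 1)).1 h1
  · exact hbig k h0

variable (L : Type*) [Field L] [DecidableEq L] [Algebra F L]

/-- The action of `SL(2, F)` on the projective line over an extension field `L`. -/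
noncomputable def mobius : SL(2, F) →* Equiv.Perm (OnePoint L) :=
  (MulAction.toPermHom (GL (Fin 2) L) (OnePoint L)).comp
    (Matrix.SpecialLinearGroup.toGL.comp (Matrix.SpecialLinearGroup.map (algebraMap F L)))

variable {L}

theorem mobius_infty_iff (g : SL(2, F)) : mobius L g OnePoint.infty = OnePoint.infty ↔ g 1 0 = 0 := by
  change (Matrix.SpecialLinearGroup.toGL (Matrix.SpecialLinearGroup.map (algebraMap F L) g)) •
    (OnePoint.infty : OnePoint L) = _ ↔ _
  rw [OnePoint.smul_infty_eq_self_iff]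
  simp

theorem mobius_coe_iff (g : SL(2, F)) (z : L) : mobius L g (z : OnePoint L) = z ↔
    algebraMap F L (g 1 0) * z ^ 2 + algebraMap F L (g 1 1 - g 0 0) * z
      - algebraMap F L (g 0 1) = 0 := by
  change (Matrix.SpecialLinearGroup.toGL (Matrix.SpecialLinearGroup.map (algebraMap F L) g)) •
    (z : OnePoint L) = _ ↔ _
  rw [← Matrix.GeneralLinearGroup.fixpointPolynomial_aeval_eq_zero_iff]
  simp [Matrix.GeneralLinearGroup.fixpointPolynomial]

theorem mobius_eq_one_iff (g : SL(2, F)) : mobius L g = 1 ↔ g = 1 ∨ g = -1 := by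
  have hinj := (algebraMap F L).injective
  constructor
  · intro h
    have hc : g 1 0 = 0 := (mobius_infty_iff (L := L) g).1 (by rw [h]; rfl)
    have hb := (mobius_coe_iff g (0 : L)).1 (by rw [h]; rfl)
    have ha := (mobius_coe_iff g (1 : L)).1 (by rw [h]; rfl)
    have hb : g 0 1 = 0 := by simpa using hb
    rw [hc, hb] at ha
    have ha : g 1 1 = g 0 0 := by
      have : algebraMap F L (g 1 1 - g 0 0) = 0 := by simpa using ha
      exact sub_eq_zero.1 ((map_eq_zero _).1 this)
    have hd := det_entries g
    rw [ha, hb] at hd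
    have : g 0 0 * g 0 0 = 1 := by linear_combination hd
    rcases mul_self_eq_one_iff.1 this with h1 | h1
    · left
      ext i j; fin_cases i <;> fin_cases j <;> simp [ha, hb, hc, h1]
    · right
      ext i j; fin_cases i <;> fin_cases j <;> simp [ha, hb, hc, h1]
  · rintro (rfl | rfl)
    · exact map_one _
    · ext x
      induction x using OnePoint.rec with
      | infty => exact (mobius_infty_iff _).2 (by simp)
      | coe z => exact (mobius_coe_iff _ z).2 (by simp)

theorem mobius_neg (g : SL(2, F)) : mobius L (-g) = mobius L g := by
  rw [neg_eq_neg_one_mul, map_mul, (mobius_eq_one_iff (L := L) (-1)).2 (Or.inr rfl), one_mul]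

open MulAction in
theorem exists_fixedBy_mobius_eq_pair
    (hL : ∀ a b : F, ∃ u v : L, ∀ z, z ^ 2 + algebraMap F L a * z + algebraMap F L b
      = (z - u) * (z - v)) (g : SL(2, F)) (hg : mobius L g ≠ 1) :
    ∃ x y : OnePoint L, fixedBy (OnePoint L) (mobius L g) = {x, y} ∧
      (x = y → (g 0 0 + g 1 1) ^ 2 = 4) := by
  have hinj := (algebraMap F L).injective
  have hdet := det_entries g
  by_cases hc : g 1 0 = 0
  · by_cases had : g 1 1 = g 0 0
    · refine ⟨OnePoint.infty, OnePoint.infty, ?_, fun _ => ?_⟩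
      · have hb : g 0 1 ≠ 0 := by
          intro hb
          apply hg
          ext x
          induction x using OnePoint.rec with
          | infty => exact (mobius_infty_iff _).2 hc
          | coe z => exact (mobius_coe_iff _ z).2 (by simp [hc, hb, had])
        ext x
        rw [mem_fixedBy, Equiv.Perm.smul_def]
        induction x using OnePoint.rec with
        | infty => simp [mobius_infty_iff, hc]
        | coe z => rw [mobius_coe_iff]; simp [hc, had, hb]
      · rw [had, hc] at hdet
        rw [had]
        linear_combination 4 * hdet
    · have h1 : algebraMap F L (g 1 1 - g 0 0) ≠ 0 := by
        rw [Ne, map_eq_zero, sub_eq_zero]; exact had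
      refine ⟨OnePoint.infty, ((algebraMap F L (g 0 1) / algebraMap F L (g 1 1 - g 0 0) : L) :
        OnePoint L), ?_, fun h => absurd h (OnePoint.infty_ne_coe _)⟩
      ext x
      rw [mem_fixedBy, Equiv.Perm.smul_def]
      induction x using OnePoint.rec with
      | infty => simp [mobius_infty_iff, hc]
      | coe z =>
        rw [mobius_coe_iff, hc, map_zero, zero_mul, zero_add, sub_eq_zero, mul_comm]
        simp only [Set.mem_insert_iff, OnePoint.coe_ne_infty, false_or, Set.mem_singleton_iff,
          OnePoint.coe_eq_coe]
        rw [eq_div_iff h1]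
  · obtain ⟨u, v, huv⟩ := hL ((g 1 1 - g 0 0) / g 1 0) (- g 0 1 / g 1 0)
    have hc' : algebraMap F L (g 1 0) ≠ 0 := by rwa [Ne, map_eq_zero]
    have hfac : ∀ z : L, algebraMap F L (g 1 0) * z ^ 2 + algebraMap F L (g 1 1 - g 0 0) * z
      - algebraMap F L (g 0 1) = algebraMap F L (g 1 0) * ((z - u) * (z - v)) := by
      intro z
      rw [← huv, map_div₀, map_div₀, map_neg]
      field_simp
      ring
    refine ⟨u, v, ?_, fun h => ?_⟩
    · ext x
      rw [mem_fixedBy, Equiv.Perm.smul_def]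
      induction x using OnePoint.rec with
      | infty => simp [mobius_infty_iff, hc]
      | coe z =>
        rw [mobius_coe_iff, hfac]
        simp [hc, sub_eq_zero]
    · have huv' : u = v := OnePoint.coe_eq_coe.1 h
      subst huv'
      have e0 := hfac 0
      have e1 := hfac 1
      apply hinj
      have hdet' := congrArg (algebraMap F L) hdet
      simp only [map_sub, map_mul, map_one, map_pow, map_add, map_ofNat] at *
      generalize algebraMap F L (g 0 0) = a at *
      generalize algebraMap F L (g 0 1) = b at *
      generalize algebraMap F L (g 1 0) = c at *
      generalize algebraMap F L (g 1 1) = d at *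
      have hb : b = - c * u ^ 2 := by linear_combination -e0
      have hd : d = a - 2 * c * u := by linear_combination e1 - e0
      rw [hb, hd] at hdet'
      rw [hd]
      linear_combination 4 * hdet'

theorem eq_one_of_mobius_unipotentHom_eq_one (α β γ : F) (h : α * α + β * γ = 0) (s : Multiplicative F)
    (hne : α ≠ 0 ∨ β ≠ 0 ∨ γ ≠ 0) (hs : mobius L (unipotentHom α β γ h s) = 1) : s = 1 := by
  by_contra h1
  have h1 : s.toAdd ≠ 0 := h1
  have hc : (unipotentHom α β γ h s) 1 0 = 0 := (mobius_infty_iff (L := L) _).1 (by rw [hs]; rfl)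
  have hb := (mobius_coe_iff (unipotentHom α β γ h s) (0 : L)).1 (by rw [hs]; rfl)
  have hc : s.toAdd * γ = 0 := hc
  have hγ : γ = 0 := by simpa [h1] using hc
  have hb : s.toAdd * β = 0 := by
    have : (unipotentHom α β γ h s) 0 1 = 0 := by simpa using hb
    exact this
  have hβ : β = 0 := by simpa [h1] using hb
  have hα : α = 0 := by simpa [hγ] using h
  simp_all

open MulAction in
theorem fixedBy_mobius_unipotentHom (α β γ : F) (h : α * α + β * γ = 0) (s : Multiplicative F)
    (hs : s ≠ 1) : fixedBy (OnePoint L) (mobius L (unipotentHom α β γ h s)) =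
      fixedBy (OnePoint L) (mobius L (unipotentHom α β γ h (Multiplicative.ofAdd 1))) := by
  have h1 : s.toAdd ≠ 0 := hs
  have h1' : algebraMap F L s.toAdd ≠ 0 := by rwa [Ne, map_eq_zero]
  ext x
  rw [mem_fixedBy, Equiv.Perm.smul_def, mem_fixedBy, Equiv.Perm.smul_def]
  induction x using OnePoint.rec with
  | infty =>
    rw [mobius_infty_iff, mobius_infty_iff]
    change s.toAdd * γ = 0 ↔ 1 * γ = 0
    simp [h1]
  | coe z =>
    rw [mobius_coe_iff, mobius_coe_iff]
    change algebraMap F L (s.toAdd * γ) * z ^ 2 + algebraMap F L (1 - s.toAdd * α - (1 + s.toAdd * α))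
      * z - algebraMap F L (s.toAdd * β) = 0 ↔ algebraMap F L (1 * γ) * z ^ 2 +
      algebraMap F L (1 - 1 * α - (1 + 1 * α)) * z - algebraMap F L (1 * β) = 0
    have e : algebraMap F L (s.toAdd * γ) * z ^ 2 +
        algebraMap F L (1 - s.toAdd * α - (1 + s.toAdd * α)) * z - algebraMap F L (s.toAdd * β) =
        algebraMap F L s.toAdd * (algebraMap F L (1 * γ) * z ^ 2 +
        algebraMap F L (1 - 1 * α - (1 + 1 * α)) * z - algebraMap F L (1 * β)) := by
      simp only [map_mul, map_sub, map_add, map_one]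
      ring
    rw [e, mul_eq_zero, or_iff_right h1']

theorem eq_top_of_unipotentHom_mem {G : Subgroup SL(2, F)} {α β γ : F} (h : α * α + β * γ = 0)
    (hne : α ≠ 0 ∨ β ≠ 0 ∨ γ ≠ 0) (hmem : ∀ s, unipotentHom α β γ h s ∈ G)
    (hglob : ∀ x : OnePoint L, ∃ g ∈ G, mobius L g x ≠ x) : G = ⊤ := by
  by_cases hγ : γ = 0
  · subst hγ
    have hα : α = 0 := by simpa using h
    subst hα
    have hβ : β ≠ 0 := by simpa using hne
    obtain ⟨g, hg, hg0⟩ := hglob OnePoint.infty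
    refine eq_top_of_upper_mem (fun t => ?_) hg (fun h0 => hg0 ((mobius_infty_iff g).2 h0))
    convert hmem (Multiplicative.ofAdd (t / β)) using 1
    apply ext_entries <;> simp [unipotentHom, hβ]
  · set z := α / γ with hz
    have hα : α = z * γ := by rw [hz]; field_simp
    have hβ : β = - z ^ 2 * γ := by
      rw [hα] at h
      have : γ * (β + z ^ 2 * γ) = 0 := by linear_combination h
      have := (mul_eq_zero.1 this).resolve_left hγ
      linear_combination this
    let C : SL(2, F) := sl2 z (-1) 1 0 (by ring)
    let C' : SL(2, F) := sl2 0 1 (-1) z (by ring)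
    have hCC : C * C' = 1 := by apply ext_entries <;> simp [C, C', mul_entry]
    have hC' : C⁻¹ = C' := inv_eq_of_mul_eq_one_right hCC
    obtain ⟨g, hg, hg0⟩ := hglob ((algebraMap F L z : L) : OnePoint L)
    have htop : G.comap (MulAut.conj C).toMonoidHom = ⊤ := by
      refine eq_top_of_upper_mem (g := C⁻¹ * g * C) (fun t => ?_) ?_ ?_
      · rw [Subgroup.mem_comap]
        convert hmem (Multiplicative.ofAdd (-t / γ)) using 1
        simp only [MulEquiv.toMonoidHom_eq_coe, MonoidHom.coe_coe, MulAut.conj_apply, hC']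
        apply ext_entries <;> simp [C, C', mul_entry, unipotentHom, hα, hβ] <;> field_simp <;> ring
      · rw [Subgroup.mem_comap]
        convert hg using 1
        simp [mul_assoc]
      · intro h0
        apply hg0
        rw [mobius_coe_iff]
        simp [hC', C, C', mul_entry] at h0
        rw [← map_pow, ← map_mul, ← map_mul, ← map_add, ← map_sub, map_eq_zero]
        linear_combination h0
    rw [eq_top_iff]
    intro k _
    have : C⁻¹ * k * C ∈ G.comap (MulAut.conj C).toMonoidHom := htop ▸ Subgroup.mem_top _
    rw [Subgroup.mem_comap] at this
    convert this using 1
    simp [mul_assoc]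

end Mobius

section Parabolic

open MulAction

variable {F : Type*} [Field F] {L : Type*} [Field L] [DecidableEq L] [Algebra F L]

theorem eq_of_trace_eq_two {g : SL(2, F)} (hg : g ≠ 1) (ht : g 0 0 + g 1 1 = 2) :
    ∃ α β γ : F, ∃ h : α * α + β * γ = 0, (α ≠ 0 ∨ β ≠ 0 ∨ γ ≠ 0) ∧
      g = unipotentHom α β γ h (Multiplicative.ofAdd 1) := by
  have hd := det_entries g
  refine ⟨g 0 0 - 1, g 0 1, g 1 0, by linear_combination g 0 0 * ht - hd, ?_, ?_⟩
  · by_contra! h0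
    obtain ⟨h00, h01, h10⟩ := h0
    refine hg (ext_entries ?_ ?_ ?_ ?_) <;> simp [h01, h10]
    · linear_combination h00
    · linear_combination ht - h00
  · apply ext_entries <;> simp [unipotentHom]
    linear_combination ht

theorem exists_eq_unipotentHom_of_fixedBy_eq_singleton
    (hL : ∀ a b : F, ∃ u v : L, ∀ z, z ^ 2 + algebraMap F L a * z + algebraMap F L b
      = (z - u) * (z - v)) {g : SL(2, F)} {x : OnePoint L}
    (hx : fixedBy (OnePoint L) (mobius L g) = {x}) :
    ∃ α β γ : F, ∃ h : α * α + β * γ = 0, (α ≠ 0 ∨ β ≠ 0 ∨ γ ≠ 0) ∧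
      (g = unipotentHom α β γ h (Multiplicative.ofAdd 1) ∨
        g = -unipotentHom α β γ h (Multiplicative.ofAdd 1)) := by
  have hg : mobius L g ≠ 1 := by
    intro h
    rw [h, fixedBy_one_eq_univ] at hx
    have h1 : OnePoint.infty ∈ ({x} : Set (OnePoint L)) := hx ▸ Set.mem_univ _
    have h2 : ((0 : L) : OnePoint L) ∈ ({x} : Set (OnePoint L)) := hx ▸ Set.mem_univ _
    exact OnePoint.infty_ne_coe _ (h1.trans h2.symm)
  obtain ⟨y, z, hyz, ht⟩ := exists_fixedBy_mobius_eq_pair hL g hg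
  have hy : y = x := by
    have : y ∈ ({x} : Set (OnePoint L)) := by rw [← hx, hyz]; simp
    exact this
  have hz : z = x := by
    have : z ∈ ({x} : Set (OnePoint L)) := by rw [← hx, hyz]; simp
    exact this
  have ht := ht (hy.trans hz.symm)
  have ht' : (g 0 0 + g 1 1 - 2) * (g 0 0 + g 1 1 + 2) = 0 := by linear_combination ht
  have hne := mt (mobius_eq_one_iff g).2 hg
  rw [not_or] at hne
  rcases mul_eq_zero.1 ht' with h2 | h2
  · obtain ⟨α, β, γ, h, hn, he⟩ := eq_of_trace_eq_two hne.1 (sub_eq_zero.1 h2)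
    exact ⟨α, β, γ, h, hn, Or.inl he⟩
  · obtain ⟨α, β, γ, h, hn, he⟩ := eq_of_trace_eq_two (g := -g)
      (fun h => hne.2 (by rw [← h, neg_neg])) (by simp; linear_combination -h2)
    exact ⟨α, β, γ, h, hn, Or.inr (by rw [← he, neg_neg])⟩

theorem exists_unipotentHom_eq_of_common_fixed {α β γ α' β' γ' : F} {h : α * α + β * γ = 0}
    {h' : α' * α' + β' * γ' = 0} (hne : α ≠ 0 ∨ β ≠ 0 ∨ γ ≠ 0) {x : OnePoint L}
    (hx : mobius L (unipotentHom α β γ h (Multiplicative.ofAdd 1)) x = x)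
    (hx' : mobius L (unipotentHom α' β' γ' h' (Multiplicative.ofAdd 1)) x = x) :
    ∃ s, unipotentHom α' β' γ' h' (Multiplicative.ofAdd 1) = unipotentHom α β γ h s := by
  have hinj := (algebraMap F L).injective
  suffices ∃ s : F, α' = s * α ∧ β' = s * β ∧ γ' = s * γ by
    obtain ⟨s, rfl, rfl, rfl⟩ := this
    refine ⟨Multiplicative.ofAdd s, ?_⟩
    apply ext_entries <;> simp [unipotentHom]
  induction x using OnePoint.rec with
  | infty =>
    rw [mobius_infty_iff] at hx hx'
    have hγ : γ = 0 := by simpa [unipotentHom] using hx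
    have hγ' : γ' = 0 := by simpa [unipotentHom] using hx'
    have hα : α = 0 := by simpa [hγ] using h
    have hα' : α' = 0 := by simpa [hγ'] using h'
    have hβ : β ≠ 0 := by simpa [hα, hγ] using hne
    exact ⟨β' / β, by simp [hα, hα'], by field_simp, by simp [hγ, hγ']⟩
  | coe z =>
    have key : ∀ {a b c : F} {hh : a * a + b * c = 0},
        mobius L (unipotentHom a b c hh (Multiplicative.ofAdd 1)) z = z →
        algebraMap F L a = algebraMap F L c * z ∧
          algebraMap F L b = - (algebraMap F L c * z ^ 2) := by
      intro a b c hh hz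
      rw [mobius_coe_iff] at hz
      simp only [unipotentHom, MonoidHom.coe_mk, OneHom.coe_mk, toAdd_ofAdd, one_mul,
        sl2_zero_zero, sl2_zero_one, sl2_one_zero, sl2_one_one, map_sub, map_add, map_one] at hz
      have hh' := congrArg (algebraMap F L) hh
      simp only [map_add, map_mul, map_zero] at hh'
      have h1 : (algebraMap F L c * z - algebraMap F L a) ^ 2 = 0 := by
        linear_combination algebraMap F L c * hz + hh'
      have h2 := sub_eq_zero.1 (pow_eq_zero_iff (two_ne_zero)|>.1 h1)
      exact ⟨h2.symm, by linear_combination -hz + 2 * z * h2⟩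
    obtain ⟨ha, hb⟩ := key hx
    obtain ⟨ha', hb'⟩ := key hx'
    have hγ : γ ≠ 0 := by
      rintro rfl
      simp only [map_zero, zero_mul, neg_zero, map_eq_zero] at ha hb
      simp [ha, hb] at hne
    have hγ' : algebraMap F L γ ≠ 0 := by rwa [Ne, map_eq_zero]
    refine ⟨γ' / γ, hinj ?_, hinj ?_, by field_simp⟩
    · rw [map_mul, map_div₀, ha, ha']; field_simp
    · rw [map_mul, map_div₀, hb, hb']; field_simp

theorem exists_subgroup_fixedBy_eq_singleton
    (hL : ∀ a b : F, ∃ u v : L, ∀ z, z ^ 2 + algebraMap F L a * z + algebraMap F L b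
      = (z - u) * (z - v)) {G : Subgroup SL(2, F)} (hneg : -1 ∈ G) (x : OnePoint L) :
    ∃ V : Subgroup (G.map (mobius L)),
      (∀ g, g ∈ V ↔ g = 1 ∨ fixedBy (OnePoint L) g = {x}) ∧
      (∀ g ∈ V, ∀ g' ∈ V, g * g' = g' * g) ∧
      (Nat.card V ≠ 1 → ∃ α β γ : F, ∃ h : α * α + β * γ = 0, (α ≠ 0 ∨ β ≠ 0 ∨ γ ≠ 0) ∧
        Nat.card V = Nat.card (G.comap (unipotentHom α β γ h))) := by
  by_cases hex : ∃ g ∈ G, fixedBy (OnePoint L) (mobius L g) = {x}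
  · obtain ⟨g, hg, hgx⟩ := hex
    obtain ⟨α, β, γ, h, hne, hU⟩ := exists_eq_unipotentHom_of_fixedBy_eq_singleton hL hgx
    have hUx : fixedBy (OnePoint L)
        (mobius L (unipotentHom α β γ h (Multiplicative.ofAdd 1))) = {x} := by
      rcases hU with rfl | rfl
      · exact hgx
      · rwa [mobius_neg] at hgx
    set f := (mobius L).comp (unipotentHom α β γ h) with hf
    have hinj : Function.Injective f := by
      rw [injective_iff_map_eq_one]
      intro s hs
      exact eq_one_of_mobius_unipotentHom_eq_one α β γ h s hne hs
    have hle : (G.comap (unipotentHom α β γ h)).map f ≤ G.map (mobius L) := by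
      rintro _ ⟨s, hs, rfl⟩
      exact ⟨_, hs, rfl⟩
    refine ⟨((G.comap (unipotentHom α β γ h)).map f).subgroupOf (G.map (mobius L)),
      ?_, ?_, fun _ => ⟨α, β, γ, h, hne, ?_⟩⟩
    · rintro ⟨k, k', hk', rfl⟩
      rw [Subgroup.mem_subgroupOf]
      constructor
      · rintro ⟨s, hs, hsk⟩
        change f s = mobius L k' at hsk
        by_cases h1 : s = 1
        · left
          ext1
          change mobius L k' = 1
          rw [← hsk, h1, map_one]
        · right
          change fixedBy (OnePoint L) (mobius L k') = {x}
          rw [← hsk, ← hUx]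
          exact fixedBy_mobius_unipotentHom α β γ h s h1
      · rintro (h1 | h1)
        · rw [h1]
          exact one_mem _
        · change fixedBy (OnePoint L) (mobius L k') = {x} at h1
          obtain ⟨α', β', γ', h', -, hU'⟩ := exists_eq_unipotentHom_of_fixedBy_eq_singleton hL h1
          have hm : mobius L (unipotentHom α' β' γ' h' (Multiplicative.ofAdd 1)) = mobius L k' := by
            rcases hU' with rfl | rfl
            · rfl
            · rw [mobius_neg]
          have hmem : unipotentHom α' β' γ' h' (Multiplicative.ofAdd 1) ∈ G := by
            rcases hU' with rfl | rfl
            · exact hk'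
            · exact mem_of_neg_mem hneg hk'
          obtain ⟨s, hs⟩ := exists_unipotentHom_eq_of_common_fixed (L := L) (x := x) hne
            (h := h) (h' := h') (by
              have : x ∈ fixedBy (OnePoint L)
                (mobius L (unipotentHom α β γ h (Multiplicative.ofAdd 1))) := by rw [hUx]; rfl
              exact this) (by
              have : x ∈ fixedBy (OnePoint L) (mobius L k') := by rw [h1]; rfl
              rw [hm]
              exact this)
          refine ⟨s, ?_, ?_⟩
          · change unipotentHom α β γ h s ∈ G
            rw [← hs]
            exact hmem
          · change mobius L (unipotentHom α β γ h s) = mobius L k'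
            rw [← hs, hm]
    · rintro ⟨_, _⟩ ⟨s, hs, hsk⟩ ⟨_, _⟩ ⟨s', hs', hsk'⟩
      ext1
      simp only [Subgroup.coe_subtype] at hsk hsk'
      simp only [Subgroup.coe_mul, ← hsk, ← hsk', ← map_mul, mul_comm]
    · rw [Nat.card_congr (Subgroup.subgroupOfEquivOfLe hle).toEquiv]
      exact (Nat.card_congr (Subgroup.equivMapOfInjective _ f hinj).toEquiv).symm
  · refine ⟨⊥, ?_, ?_, ?_⟩
    · rintro ⟨k, k', hk', rfl⟩
      rw [Subgroup.mem_bot, iff_self_or]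
      intro hk
      exact absurd ⟨k', hk', hk⟩ hex
    · simp
    · simp

end Parabolic

theorem exists_finite_extension_quadratic_splits.{u} (F : Type u) [Field F] [Finite F] :
    ∃ (L : Type u) (_ : Field L) (_ : Algebra F L), Finite L ∧
      ∀ a b : F, ∃ u v : L, ∀ z, z ^ 2 + algebraMap F L a * z + algebraMap F L b
        = (z - u) * (z - v) := by
  classical
  have := Fintype.ofFinite F
  let f : F × F → Polynomial F := fun c =>
    Polynomial.X ^ 2 + Polynomial.C c.1 * Polynomial.X + Polynomial.C c.2
  let P : Polynomial F := ∏ c, f c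
  have hf : ∀ c, (f c).natDegree = 2 := fun c => by simp only [f]; compute_degree!
  have hf0 : ∀ c, f c ≠ 0 := fun c h => by simpa [h] using hf c
  refine ⟨P.SplittingField, inferInstance, inferInstance,
    Module.finite_of_finite F, fun a b => ?_⟩
  have hs : ((f (a, b)).map (algebraMap F P.SplittingField)).Splits := by
    refine Polynomial.Splits.of_dvd (Polynomial.SplittingField.splits P) ?_ ?_
    · rw [Polynomial.map_ne_zero_iff (algebraMap F P.SplittingField).injective]
      exact Finset.prod_ne_zero_iff.2 fun c _ => hf0 c
    · exact Polynomial.map_dvd _ (Finset.dvd_prod_of_mem f (Finset.mem_univ (a, b)))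
  obtain ⟨u, hu⟩ := hs.exists_eval_eq_zero (by
    rw [Polynomial.degree_map, Polynomial.degree_eq_natDegree (hf0 _), hf]
    decide)
  refine ⟨u, -algebraMap F P.SplittingField a - u, fun z => ?_⟩
  simp only [f, Polynomial.eval_map_algebraMap, map_add, map_mul, map_pow, Polynomial.aeval_X,
    Polynomial.aeval_C] at hu
  linear_combination hu

section Generation

variable {F : Type*} [Field F] {L : Type*} [Field L] [DecidableEq L] [Algebra F L]

theorem eq_top_of_orderOf_eq_seven [Finite F] [Finite L]
    (hL : ∀ a b : F, ∃ u v : L, ∀ z, z ^ 2 + algebraMap F L a * z + algebraMap F L b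
      = (z - u) * (z - v)) {p n : ℕ} (hp : p.Prime) (hq : Nat.card F = p ^ n)
    (hpow : ∀ k, k ≤ n → k ≠ 0 → (7 ∣ p ^ k ∨ 7 ∣ p ^ k - 1 ∨ 7 ∣ p ^ k + 1) → k = n)
    {G : Subgroup SL(2, F)} (hneg : -1 ∈ G)
    (hglob : ∀ x : OnePoint L, ∃ g ∈ G, mobius L g x ≠ x)
    (hidx : ∀ K : Subgroup (G.map (mobius L)), K.index ≠ 2)
    {r : G.map (mobius L)} (hr : orderOf r = 7) : G = ⊤ := by
  have : Finite (OnePoint L) := inferInstanceAs (Finite (Option L))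
  have : Finite (Equiv.Perm (OnePoint L)) := Equiv.finite_left
  choose V hV hcomm hcard using exists_subgroup_fixedBy_eq_singleton (G := G) hL hneg
  obtain ⟨x, hx1, hx7⟩ := exists_seven_dvd_of_fixedBy (H := G.map (mobius L)) (Ω := OnePoint L)
    (by
      rintro ⟨_, g, hg, rfl⟩ hne
      obtain ⟨x, y, hxy, -⟩ := exists_fixedBy_mobius_eq_pair hL g (fun h => hne (Subtype.ext h))
      exact ⟨x, y, hxy⟩) V hV hcomm
    (fun x => by
      obtain ⟨g, hg, hgx⟩ := hglob x
      exact ⟨⟨_, g, hg, rfl⟩, hgx⟩) hidx hr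
  obtain ⟨α, β, γ, h, hne, hVc⟩ := hcard x hx1
  have hdvd : Nat.card (V x) ∣ p ^ n := by
    rw [hVc, ← hq]
    exact Subgroup.card_subgroup_dvd_card (G.comap (unipotentHom α β γ h))
  obtain ⟨k, hk, hkV⟩ := (Nat.dvd_prime_pow hp).1 hdvd
  rw [hkV] at hx1 hx7
  have hkn := hpow k hk (by rintro rfl; simp at hx1) hx7
  have htop : G.comap (unipotentHom α β γ h) = ⊤ := by
    apply Subgroup.eq_top_of_card_eq
    rw [← hVc, hkV, hkn, ← hq]
    rfl
  refine eq_top_of_unipotentHom_mem (L := L) h hne (fun s => ?_) hglob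
  have : s ∈ G.comap (unipotentHom α β γ h) := htop ▸ Subgroup.mem_top s
  exact this

end Generation

section Trace

variable {F : Type*} [Field F]

theorem pow_succ_entry {g : SL(2, F)} {τ a b : F} (hτ : g 0 0 + g 1 1 = τ) {k : ℕ}
    (hk : ∀ i j, (g ^ k) i j = a * g i j - b * (1 : SL(2, F)) i j) (i j : Fin 2) :
    (g ^ (k + 1)) i j = (a * τ - b) * g i j - a * (1 : SL(2, F)) i j := by
  have hd := det_entries g
  rw [pow_succ, mul_entry, hk, hk, ← hτ]
  fin_cases i <;> fin_cases j <;> simp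
  · linear_combination -a * hd
  · ring
  · ring
  · linear_combination -a * hd

theorem sq_entry {g : SL(2, F)} {τ : F} (hτ : g 0 0 + g 1 1 = τ) (i j : Fin 2) :
    (g ^ 2) i j = τ * g i j - (1 : SL(2, F)) i j := by
  have := pow_succ_entry (k := 1) (a := 1) (b := 0) hτ (fun i j => by simp) i j
  rw [this]; ring

theorem pow_three_entry {g : SL(2, F)} {τ : F} (hτ : g 0 0 + g 1 1 = τ) (i j : Fin 2) :
    (g ^ 3) i j = (τ ^ 2 - 1) * g i j - τ * (1 : SL(2, F)) i j := by
  have := pow_succ_entry (k := 2) (a := τ) (b := 1) hτ (fun i j => by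
    rw [sq_entry hτ]; ring) i j
  rw [this]; ring

theorem pow_seven_entry {g : SL(2, F)} {τ : F} (hτ : g 0 0 + g 1 1 = τ) (i j : Fin 2) :
    (g ^ 7) i j = (τ ^ 3 + τ ^ 2 - 2 * τ - 1) * (τ ^ 3 - τ ^ 2 - 2 * τ + 1) * g i j
      - (τ ^ 5 - 4 * τ ^ 3 + 3 * τ) * (1 : SL(2, F)) i j := by
  have := pow_succ_entry hτ (pow_succ_entry hτ (pow_succ_entry hτ (pow_succ_entry hτ
    (pow_three_entry hτ)))) i j
  rw [this]; ring

theorem sq_eq_neg_one_of_trace {g : SL(2, F)} (hτ : g 0 0 + g 1 1 = 0) : g ^ 2 = -1 := by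
  apply ext_entries <;> rw [sq_entry hτ] <;> simp

theorem pow_three_eq_neg_one_of_trace {g : SL(2, F)} (hτ : g 0 0 + g 1 1 = 1) : g ^ 3 = -1 := by
  apply ext_entries <;> rw [pow_three_entry hτ] <;> simp

theorem pow_seven_eq_one_of_trace {g : SL(2, F)} {c : F} (hτ : g 0 0 + g 1 1 = c)
    (hc : c ^ 3 + c ^ 2 - 2 * c - 1 = 0) : g ^ 7 = 1 := by
  have h : c ^ 5 - 4 * c ^ 3 + 3 * c = -1 := by linear_combination (c ^ 2 - c - 1) * hc
  apply ext_entries <;> rw [pow_seven_entry hτ, hc, h] <;> simp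

theorem neg_one_mem_center : (-1 : SL(2, F)) ∈ Subgroup.center SL(2, F) := by
  rw [Subgroup.mem_center_iff]; simp

theorem exists_surjective_of_closure_eq_top {X Y : SL(2, F)} (hX : X ^ 2 = -1) (hY : Y ^ 3 = -1)
    (hXY : (X * Y) ^ 7 = 1) (htop : Subgroup.closure {X, Y} = ⊤) :
    ∃ φ : TriangleGroup237 →* PSL(2, F), Function.Surjective φ := by
  let π : SL(2, F) →* PSL(2, F) := QuotientGroup.mk' (Subgroup.center SL(2, F))
  have hπ : π (-1) = 1 := (QuotientGroup.eq_one_iff _).2 neg_one_mem_center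
  have hrel : ∀ r ∈ triangleRels237, FreeGroup.lift ![π X, π Y] r = 1 := by
    rintro r (rfl | rfl | rfl)
    · simp only [map_pow, FreeGroup.lift_apply_of, Matrix.cons_val_zero]
      rw [← map_pow, hX, hπ]
    · simp only [map_pow, FreeGroup.lift_apply_of, Matrix.cons_val_one,
        Matrix.cons_val_zero]
      rw [← map_pow, hY, hπ]
    · simp only [map_pow, map_mul, FreeGroup.lift_apply_of, Matrix.cons_val_zero,
        Matrix.cons_val_one]
      rw [← map_mul, ← map_pow, hXY, map_one]
  let φ := PresentedGroup.toGroup hrel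
  refine ⟨φ, ?_⟩
  have hle : (⊤ : Subgroup SL(2, F)) ≤ φ.range.comap π := by
    rw [← htop, Subgroup.closure_le]
    rintro g (rfl | rfl)
    · exact ⟨PresentedGroup.of 0, by simp [φ]⟩
    · exact ⟨PresentedGroup.of 1, by simp [φ]⟩
  intro x
  obtain ⟨g, rfl⟩ := QuotientGroup.mk'_surjective _ x
  exact hle (Subgroup.mem_top g)

end Trace

theorem index_ne_two_of_closure_eq_top {H : Type*} [Group H] {x y : H} (hx : x ^ 2 = 1)
    (hy : y ^ 3 = 1) (hxy : (x * y) ^ 7 = 1) (htop : Subgroup.closure {x, y} = ⊤)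
    (K : Subgroup H) : K.index ≠ 2 := by
  intro hK
  have hyK : y ∈ K := by
    have h := K.mul_mem (Subgroup.sq_mem_of_index_two hK y) (Subgroup.sq_mem_of_index_two hK y)
    rwa [← pow_add, pow_succ, hy, one_mul] at h
  have hxyK : x * y ∈ K := by
    have h := K.pow_mem (Subgroup.sq_mem_of_index_two hK (x * y)) 4
    rwa [← pow_mul, pow_succ, hxy, one_mul] at h
  have hxK : x ∈ K := (Subgroup.mul_mem_cancel_right _ hyK).1 hxyK
  have : K = ⊤ := by
    rw [eq_top_iff, ← htop, Subgroup.closure_le]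
    rintro g (rfl | rfl) <;> assumption
  rw [this, Subgroup.index_top] at hK
  omega

section Generators

variable {F : Type*} [Field F]

theorem exists_quadratic_form_eq_zero [Finite F] {c : F} (hc0 : c ≠ 0) :
    ∃ u w : F, u ^ 2 + u * w + w ^ 2 + c * w + 1 = 0 := by
  have := Fintype.ofFinite F
  by_cases h2 : (2 : F) = 0
  · exact ⟨c, c + 1, by linear_combination (2 * c ^ 2 + 2 * c + 1) * h2⟩
  by_cases h3 : (3 : F) = 0
  · refine ⟨-1 / c, -1 / c, ?_⟩
    field_simp
    linear_combination h3
  · have hodd : Fintype.card F % 2 = 1 := by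
      apply FiniteField.odd_card_of_char_ne_two
      intro h
      apply h2
      have := ringChar.spec F 2
      rw [h] at this
      exact_mod_cast this.2 dvd_rfl
    obtain ⟨s, w, h⟩ := FiniteField.exists_root_sum_quadratic
      (f := (Polynomial.X ^ 2 : Polynomial F))
      (g := Polynomial.C 3 * Polynomial.X ^ 2 + Polynomial.C (4 * c) * Polynomial.X +
        Polynomial.C 4) (by simp) (Polynomial.degree_quadratic h3) hodd
    simp only [Polynomial.eval_add, Polynomial.eval_mul, Polynomial.eval_pow, Polynomial.eval_X,
      Polynomial.eval_C] at h
    refine ⟨(s - w) / 2, w, ?_⟩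
    field_simp
    linear_combination h

theorem exists_surjective_of_cubic_root [Finite F] {p n : ℕ} (hp : p.Prime)
    (hq : Nat.card F = p ^ n)
    (hpow : ∀ k, k ≤ n → k ≠ 0 → (7 ∣ p ^ k ∨ 7 ∣ p ^ k - 1 ∨ 7 ∣ p ^ k + 1) → k = n)
    {c : F} (hc : c ^ 3 + c ^ 2 - 2 * c - 1 = 0) :
    ∃ φ : TriangleGroup237 →* PSL(2, F), Function.Surjective φ := by
  classical
  obtain ⟨L, _, _, _, hL⟩ := exists_finite_extension_quadratic_splits F
  obtain ⟨u, w, huw⟩ := exists_quadratic_form_eq_zero (c := c) (by rintro rfl; simp at hc)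
  let X : SL(2, F) := sl2 u (c + w + u) w (-u) (by linear_combination -huw)
  let Y : SL(2, F) := sl2 0 (-1) 1 1 (by ring)
  have hX : X ^ 2 = -1 := sq_eq_neg_one_of_trace (by simp [X])
  have hY : Y ^ 3 = -1 := pow_three_eq_neg_one_of_trace (by simp [Y])
  have hXY : (X * Y) ^ 7 = 1 := pow_seven_eq_one_of_trace (c := c)
    (by simp [X, Y, mul_entry]; ring) hc
  set G := Subgroup.closure {X, Y} with hG
  have hXG : X ∈ G := Subgroup.subset_closure (by simp)
  have hYG : Y ∈ G := Subgroup.subset_closure (by simp)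
  have hneg1 : mobius L (-1 : SL(2, F)) = 1 := (mobius_eq_one_iff _).2 (Or.inr rfl)
  let x : G.map (mobius L) := ⟨mobius L X, X, hXG, rfl⟩
  let y : G.map (mobius L) := ⟨mobius L Y, Y, hYG, rfl⟩
  have hxy : (x * y) ^ 7 = 1 := by
    ext1
    change (mobius L X * mobius L Y) ^ 7 = 1
    rw [← map_mul, ← map_pow, hXY, map_one]
  have htop : Subgroup.closure {x, y} = ⊤ := by
    have hle : G ≤ ((Subgroup.closure {x, y}).map (G.map (mobius L)).subtype).comap
        (mobius L) := by
      refine (Subgroup.closure_le _).2 ?_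
      rintro g (rfl | rfl)
      · exact ⟨x, Subgroup.subset_closure (by simp), rfl⟩
      · exact ⟨y, Subgroup.subset_closure (by simp), rfl⟩
    rw [eq_top_iff]
    rintro ⟨_, g, hg, rfl⟩ -
    obtain ⟨k, hk, hkg⟩ := hle hg
    have e : k = ⟨mobius L g, g, hg, rfl⟩ := Subtype.ext hkg
    rwa [e] at hk
  refine exists_surjective_of_closure_eq_top hX hY hXY ?_
  refine eq_top_of_orderOf_eq_seven (r := x * y) hL hp hq hpow ?_ ?_
    (index_ne_two_of_closure_eq_top ?_ ?_ hxy htop) ?_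
  · rw [← hX]
    exact pow_mem hXG 2
  · by_contra! h
    obtain ⟨z, hz⟩ := h
    have hXz := hz X hXG
    have hYz := hz Y hYG
    induction z using OnePoint.rec with
    | infty =>
      rw [mobius_infty_iff] at hYz
      simp [Y] at hYz
    | coe z =>
      rw [mobius_coe_iff] at hXz hYz
      simp only [X, Y, sl2_zero_zero, sl2_zero_one, sl2_one_zero, sl2_one_one, map_sub, map_add,
        map_neg, map_one, map_zero] at hXz hYz
      have huw' := congrArg (algebraMap F L) huw
      simp only [map_add, map_mul, map_pow, map_one, map_zero] at huw'
      have h3 : algebraMap F L (c ^ 2 - 3) = 0 := by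
        simp only [map_sub, map_pow, map_ofNat]
        generalize algebraMap F L u = u at *
        generalize algebraMap F L w = w at *
        generalize algebraMap F L c = c at *
        have e : 2 * w + u + c = -((w + 2 * u) * z) := by
          linear_combination w * hYz - hXz
        linear_combination (w + 2 * u) ^ 2 * hYz - 3 * huw' +
          (2 * w + u + c - (w + 2 * u) * z - (w + 2 * u)) * e
      have h3 : c ^ 2 - 3 = 0 := (map_eq_zero _).1 h3
      have hc2 : c + 2 = 0 := by linear_combination hc - (c + 1) * h3
      exact one_ne_zero (α := F) (by linear_combination h3 - (c - 2) * hc2)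
  · ext1
    change (mobius L X) ^ 2 = 1
    rw [← map_pow, hX, hneg1]
  · ext1
    change (mobius L Y) ^ 3 = 1
    rw [← map_pow, hY, hneg1]
  · have : Fact (Nat.Prime 7) := ⟨by norm_num⟩
    refine orderOf_eq_prime hxy fun h1 => ?_
    have h1 : mobius L (X * Y) = 1 := by
      rw [map_mul]
      exact congrArg Subtype.val h1
    rw [mobius_eq_one_iff] at h1
    have e00 : (X * Y) 0 0 = c + w + u := by simp [X, Y, mul_entry]
    have e01 : (X * Y) 0 1 = -u + (c + w + u) := by simp [X, Y, mul_entry]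
    have e10 : (X * Y) 1 0 = -u := by simp [X, Y, mul_entry]
    rcases h1 with h1 | h1 <;> rw [h1] at e00 e01 e10
    all_goals
      have hu : u = 0 := by simpa using e10
      have hcw : c + w = 0 := by simpa [hu] using e01.symm
      simp [hu, hcw] at e00

end Generators

section TraceField

variable {F : Type*} [Field F]

/-- `A` is an `S`-linear combination of `1`, `X`, `Y` and `X * Y`. -/
def InOrder (S : Subring F) (X Y A : SL(2, F)) : Prop :=
  ∃ a ∈ S, ∃ b ∈ S, ∃ c ∈ S, ∃ d ∈ S, ∀ i j, A i j =
    a * (1 : SL(2, F)) i j + b * X i j + c * Y i j + d * (X * Y) i j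

section InOrder

variable {S : Subring F} {X Y A : SL(2, F)}

theorem InOrder.mul_left_fst (hX : X 0 0 + X 1 1 ∈ S) (h : InOrder S X Y A) :
    InOrder S X Y (X * A) := by
  obtain ⟨a, ha, b, hb, c, hc, d, hd, h⟩ := h
  refine ⟨-b, neg_mem hb, a + b * (X 0 0 + X 1 1), add_mem ha (mul_mem hb hX), -d, neg_mem hd,
    c + d * (X 0 0 + X 1 1), add_mem hc (mul_mem hd hX), fun i j => ?_⟩
  have hdet := det_entries X
  rw [mul_entry, h, h]
  fin_cases i <;> fin_cases j <;> simp [mul_entry]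
  · linear_combination (-b - d * Y 0 0) * hdet
  · linear_combination (-d * Y 0 1) * hdet
  · linear_combination (-d * Y 1 0) * hdet
  · linear_combination (-b - d * Y 1 1) * hdet

theorem InOrder.mul_left_snd (hX : X 0 0 + X 1 1 ∈ S) (hY : Y 0 0 + Y 1 1 ∈ S)
    (hXY : (X * Y) 0 0 + (X * Y) 1 1 ∈ S) (h : InOrder S X Y A) :
    InOrder S X Y (Y * A) := by
  obtain ⟨a, ha, b, hb, c, hc, d, hd, h⟩ := h
  refine ⟨b * ((X * Y) 0 0 + (X * Y) 1 1 - (X 0 0 + X 1 1) * (Y 0 0 + Y 1 1)) - c -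
      d * (X 0 0 + X 1 1),
    sub_mem (sub_mem (mul_mem hb (sub_mem hXY (mul_mem hX hY))) hc) (mul_mem hd hX),
    b * (Y 0 0 + Y 1 1) + d, add_mem (mul_mem hb hY) hd,
    a + b * (X 0 0 + X 1 1) + c * (Y 0 0 + Y 1 1) + d * ((X * Y) 0 0 + (X * Y) 1 1),
    add_mem (add_mem (add_mem ha (mul_mem hb hX)) (mul_mem hc hY)) (mul_mem hd hXY),
    -b, neg_mem hb, fun i j => ?_⟩
  have hdet := det_entries Y
  rw [mul_entry, h, h]
  fin_cases i <;> fin_cases j <;> simp [mul_entry]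
  · linear_combination (-c - d * X 1 1) * hdet
  · linear_combination (d * X 0 1) * hdet
  · linear_combination (d * X 1 0) * hdet
  · linear_combination (-c - d * X 0 0) * hdet

theorem InOrder.inv_mul {B : SL(2, F)} (hB : B 0 0 + B 1 1 ∈ S) (h : InOrder S X Y A)
    (h' : InOrder S X Y (B * A)) : InOrder S X Y (B⁻¹ * A) := by
  obtain ⟨a, ha, b, hb, c, hc, d, hd, h⟩ := h
  obtain ⟨a', ha', b', hb', c', hc', d', hd', h'⟩ := h'
  refine ⟨(B 0 0 + B 1 1) * a - a', sub_mem (mul_mem hB ha) ha',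
    (B 0 0 + B 1 1) * b - b', sub_mem (mul_mem hB hb) hb',
    (B 0 0 + B 1 1) * c - c', sub_mem (mul_mem hB hc) hc',
    (B 0 0 + B 1 1) * d - d', sub_mem (mul_mem hB hd) hd', fun i j => ?_⟩
  have e : (B⁻¹ * A) i j = (B 0 0 + B 1 1) * A i j - (B * A) i j := by
    rw [mul_entry, mul_entry, Matrix.SpecialLinearGroup.SL2_inv_expl]
    fin_cases i <;> fin_cases j <;> simp <;> ring
  rw [e, h, h']
  ring

theorem trace_mem_of_mem_closure (hX : X 0 0 + X 1 1 ∈ S) (hY : Y 0 0 + Y 1 1 ∈ S)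
    (hXY : (X * Y) 0 0 + (X * Y) 1 1 ∈ S)
    (hA : A ∈ Subgroup.closure {X, Y}) : A 0 0 + A 1 1 ∈ S := by
  have h : InOrder S X Y A := by
    induction hA using Subgroup.closure_induction_left with
    | one => exact ⟨1, one_mem _, 0, zero_mem _, 0, zero_mem _, 0, zero_mem _, fun i j => by simp⟩
    | mul_left x hx y _ ih =>
      rcases hx with rfl | rfl
      · exact ih.mul_left_fst hX
      · exact ih.mul_left_snd hX hY hXY
    | inv_mul_cancel x hx y _ ih =>
      rcases hx with rfl | rfl
      · exact ih.inv_mul hX (ih.mul_left_fst hX)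
      · exact ih.inv_mul hY (ih.mul_left_snd hX hY hXY)
  obtain ⟨a, ha, b, hb, c, hc, d, hd, h⟩ := h
  have e : A 0 0 + A 1 1 = a + a + b * (X 0 0 + X 1 1) + c * (Y 0 0 + Y 1 1) +
      d * ((X * Y) 0 0 + (X * Y) 1 1) := by
    rw [h, h]; simp; ring
  rw [e]
  exact add_mem (add_mem (add_mem (add_mem ha ha) (mul_mem hb hX)) (mul_mem hc hY))
    (mul_mem hd hXY)

end InOrder

theorem eq_one_or_eq_neg_one_of_mem_center {g : SL(2, F)}
    (hg : g ∈ Subgroup.center SL(2, F)) : g = 1 ∨ g = -1 := by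
  obtain ⟨r, hr, h⟩ := Matrix.SpecialLinearGroup.mem_center_iff.1 hg
  have hr : r * r = 1 := by simpa [sq] using hr
  have e : ∀ i j, g i j = Matrix.scalar (Fin 2) r i j := fun i j => by rw [h]
  rcases mul_self_eq_one_iff.1 hr with rfl | rfl
  · left; apply ext_entries <;> rw [e] <;> simp
  · right; apply ext_entries <;> rw [e] <;> simp

theorem exists_cubic_root_of_pow_seven {Z : SL(2, F)} (h7 : Z ^ 7 = 1 ∨ Z ^ 7 = -1) (h1 : Z ≠ 1)
    (h2 : Z ≠ -1) : ∃ c, c ^ 3 + c ^ 2 - 2 * c - 1 = 0 ∧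
      (Z 0 0 + Z 1 1 = c ∨ Z 0 0 + Z 1 1 = -c) := by
  set τ := Z 0 0 + Z 1 1 with hτ
  suffices (τ ^ 3 + τ ^ 2 - 2 * τ - 1) * (τ ^ 3 - τ ^ 2 - 2 * τ + 1) = 0 by
    rcases mul_eq_zero.1 this with h | h
    · exact ⟨τ, h, Or.inl rfl⟩
    · exact ⟨-τ, by linear_combination -h, Or.inr (by ring)⟩
  by_contra hP
  obtain ⟨ε, hε⟩ : ∃ ε : F, ∀ i j, (Z ^ 7) i j = ε * (1 : SL(2, F)) i j := by
    rcases h7 with h | h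
    · exact ⟨1, fun i j => by rw [h, one_mul]⟩
    · exact ⟨-1, fun i j => by simp [h]⟩
  simp only [pow_seven_entry hτ.symm] at hε
  have h00 := hε 0 0
  have h01 := hε 0 1
  have h10 := hε 1 0
  have h11 := hε 1 1
  simp [hP] at h01 h10
  have hd : Z 0 0 = Z 1 1 := by
    simp at h00 h11
    exact mul_left_cancel₀ hP (by linear_combination h00 - h11)
  have hdet := det_entries Z
  rw [h01, ← hd] at hdet
  rcases mul_self_eq_one_iff.1 (show Z 0 0 * Z 0 0 = 1 by linear_combination hdet) with h | h
  · exact h1 (by apply ext_entries <;> simp [h01, h10, ← hd, h])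
  · exact h2 (by apply ext_entries <;> simp [h01, h10, ← hd, h])

theorem exists_cubic_root_of_surjective {φ : TriangleGroup237 →* PSL(2, F)}
    (hφ : Function.Surjective φ) :
    ∃ c : F, c ^ 3 + c ^ 2 - 2 * c - 1 = 0 ∧ ∀ S : Subring F, c ∈ S → S = ⊤ := by
  let π : SL(2, F) →* PSL(2, F) := QuotientGroup.mk' (Subgroup.center SL(2, F))
  have hπ : ∀ g, π g = 1 ↔ g = 1 ∨ g = -1 := by
    refine fun g => (QuotientGroup.eq_one_iff g).trans ⟨eq_one_or_eq_neg_one_of_mem_center, ?_⟩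
    rintro (rfl | rfl)
    · exact one_mem _
    · exact neg_one_mem_center
  obtain ⟨X, hX⟩ := QuotientGroup.mk'_surjective _ (φ (PresentedGroup.of 0))
  obtain ⟨Y, hY⟩ := QuotientGroup.mk'_surjective _ (φ (PresentedGroup.of 1))
  change π X = _ at hX
  change π Y = _ at hY
  have hrel : ∀ r ∈ triangleRels237, φ (PresentedGroup.mk triangleRels237 r) = 1 := fun r hr => by
    rw [PresentedGroup.one_of_mem hr, map_one]
  have hX2 : π (X ^ 2) = 1 := by
    rw [map_pow, hX, ← map_pow]
    exact hrel (FreeGroup.of 0 ^ 2) (Or.inl rfl)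
  have hY3 : π (Y ^ 3) = 1 := by
    rw [map_pow, hY, ← map_pow]
    exact hrel (FreeGroup.of 1 ^ 3) (Or.inr (Or.inl rfl))
  have hXY7 : π ((X * Y) ^ 7) = 1 := by
    rw [map_pow, map_mul, hX, hY, ← map_mul, ← map_pow]
    exact hrel ((FreeGroup.of 0 * FreeGroup.of 1) ^ 7) (Or.inr (Or.inr rfl))
  have hsurj : ∀ A, ∃ B ∈ Subgroup.closure {X, Y}, π B = π A := by
    have hle : (⊤ : Subgroup TriangleGroup237) ≤
        ((Subgroup.closure {X, Y}).map π).comap φ := by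
      rw [← PresentedGroup.closure_range_of, Subgroup.closure_le]
      rintro _ ⟨i, rfl⟩
      fin_cases i
      · exact ⟨X, Subgroup.subset_closure (by simp), hX⟩
      · exact ⟨Y, Subgroup.subset_closure (by simp), hY⟩
    intro A
    obtain ⟨w, hw⟩ := hφ (π A)
    obtain ⟨B, hB, hBw⟩ := hle (Subgroup.mem_top w)
    exact ⟨B, hB, hBw.trans hw⟩
  have hXY : π (X * Y) ≠ 1 := by
    intro h
    rw [map_pow] at hX2 hY3
    rw [map_mul] at h
    have hyx := eq_inv_of_mul_eq_one_right h
    have hX1 : π X = 1 := by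
      rw [hyx, inv_pow, inv_eq_one, pow_succ, hX2, one_mul] at hY3
      exact hY3
    rw [hX1, one_mul] at h
    have hle : Subgroup.closure {X, Y} ≤ π.ker := by
      rw [Subgroup.closure_le]
      rintro g (rfl | rfl)
      · exact hX1
      · exact h
    obtain ⟨B, hB, hBA⟩ := hsurj (sl2 1 1 0 1 (by ring))
    rw [MonoidHom.mem_ker.1 (hle hB), eq_comm, hπ] at hBA
    rcases hBA with h0 | h0 <;>
      simpa using congrArg (fun g : SL(2, F) => g 0 1) h0
  rw [hπ] at hX2 hY3 hXY7
  rw [Ne, hπ, not_or] at hXY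
  obtain ⟨c, hc, hcZ⟩ := exists_cubic_root_of_pow_seven hXY7 hXY.1 hXY.2
  refine ⟨c, hc, fun S hcS => ?_⟩
  have h1S : (1 : F) ∈ S := one_mem S
  have h2S : (2 : F) ∈ S := by simp
  have hZS : (X * Y) 0 0 + (X * Y) 1 1 ∈ S := by
    rcases hcZ with h | h <;> rw [h]
    · exact hcS
    · exact neg_mem hcS
  have hXS : X 0 0 + X 1 1 ∈ S := by
    have e00 := sq_entry (g := X) rfl 0 0
    have e11 := sq_entry (g := X) rfl 1 1
    generalize hτ : X 0 0 + X 1 1 = τ at *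
    rcases hX2 with h | h <;> rw [h] at e00 e11 <;> simp at e00 e11
    · have : (τ - 2) * (τ + 2) = 0 := by linear_combination -e00 - e11 - τ * hτ
      rcases mul_eq_zero.1 this with h | h
      · rwa [sub_eq_zero.1 h]
      · rw [eq_neg_of_add_eq_zero_left h]
        exact neg_mem h2S
    · have : τ * τ = 0 := by linear_combination -e00 - e11 - τ * hτ
      rw [mul_self_eq_zero.1 this]
      exact zero_mem S
  have hYS : Y 0 0 + Y 1 1 ∈ S := by
    have e00 := pow_three_entry (g := Y) rfl 0 0
    have e11 := pow_three_entry (g := Y) rfl 1 1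
    generalize hτ : Y 0 0 + Y 1 1 = τ at *
    rcases hY3 with h | h <;> rw [h] at e00 e11 <;> simp at e00 e11
    · have : (τ - 2) * (τ + 1) ^ 2 = 0 := by
        linear_combination -e00 - e11 - (τ ^ 2 - 1) * hτ
      rcases mul_eq_zero.1 this with h | h
      · rwa [sub_eq_zero.1 h]
      · rw [eq_neg_of_add_eq_zero_left (pow_eq_zero_iff two_ne_zero |>.1 h)]
        exact neg_mem h1S
    · have : (τ + 2) * (τ - 1) ^ 2 = 0 := by
        linear_combination -e00 - e11 - (τ ^ 2 - 1) * hτ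
      rcases mul_eq_zero.1 this with h | h
      · rw [eq_neg_of_add_eq_zero_left h]
        exact neg_mem h2S
      · rwa [sub_eq_zero.1 (pow_eq_zero_iff two_ne_zero |>.1 h)]
  rw [eq_top_iff]
  intro a _
  obtain ⟨B, hB, hBA⟩ := hsurj (sl2 a (-1) 1 0 (by ring))
  have hBS := trace_mem_of_mem_closure hXS hYS hZS hB
  rw [← inv_mul_eq_one, ← map_inv, ← map_mul, hπ, inv_mul_eq_one, inv_mul_eq_iff_eq_mul] at hBA
  rcases hBA with rfl | h
  · simpa using hBS
  · have e : a = -(B 0 0 + B 1 1) := by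
      have h0 := congrArg (fun g : SL(2, F) => g 0 0 + g 1 1) h
      simp at h0
      linear_combination h0
    rw [e]
    exact neg_mem hBS

end TraceField

section FiniteFields

variable {F : Type*} [Field F]

theorem card_le_of_forall_pow_eq_self [Finite F] {m : ℕ} (hm : 1 < m) (h : ∀ a : F, a ^ m = a) :
    Nat.card F ≤ m := by
  classical
  have := Fintype.ofFinite F
  have h0 := FiniteField.X_pow_card_sub_X_ne_zero F hm
  have hle : (Finset.univ : Finset F) ⊆
      (Polynomial.X ^ m - Polynomial.X : Polynomial F).roots.toFinset := by
    intro a _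
    rw [Multiset.mem_toFinset, Polynomial.mem_roots h0]
    simp [h a]
  rw [Nat.card_eq_fintype_card, ← Finset.card_univ,
    ← FiniteField.X_pow_card_sub_X_natDegree_eq F hm]
  exact (Finset.card_le_card hle).trans
    ((Multiset.toFinset_card_le _).trans (Polynomial.card_roots' _))

theorem mem_range_algebraMap_of_pow_card_eq_self [Finite F] {K : Type*} [Field K] [Algebra F K]
    {x : K} (hx : x ^ Nat.card F = x) : x ∈ Set.range (algebraMap F K) := by
  classical
  have := Fintype.ofFinite F
  have hm : 1 < Nat.card F := Finite.one_lt_card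
  have h0 := FiniteField.X_pow_card_sub_X_ne_zero K hm
  set P := (Polynomial.X ^ Nat.card F - Polynomial.X : Polynomial K)
  have hle : Finset.univ.image (algebraMap F K) ⊆ P.roots.toFinset := by
    intro y hy
    obtain ⟨a, -, rfl⟩ := Finset.mem_image.1 hy
    rw [Multiset.mem_toFinset, Polynomial.mem_roots h0]
    simp [P, ← map_pow, Nat.card_eq_fintype_card, FiniteField.pow_card]
  have hcard : P.roots.toFinset.card ≤ (Finset.univ.image (algebraMap F K)).card := by
    rw [Finset.card_image_of_injective _ (algebraMap F K).injective, Finset.card_univ,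
      ← Nat.card_eq_fintype_card, ← FiniteField.X_pow_card_sub_X_natDegree_eq K hm]
    exact (Multiset.toFinset_card_le _).trans (Polynomial.card_roots' _)
  have hmem : x ∈ P.roots.toFinset := by
    rw [Multiset.mem_toFinset, Polynomial.mem_roots h0, Polynomial.IsRoot.def, Polynomial.eval_sub,
      Polynomial.eval_pow, Polynomial.eval_X, hx, sub_self]
  rw [← Finset.eq_of_subset_of_card_le hle hcard] at hmem
  simpa using hmem

theorem exists_seventh_root_of_cubic [IsAlgClosed F] {c : F}
    (hc : c ^ 3 + c ^ 2 - 2 * c - 1 = 0) : ∃ t : F, t ^ 7 = 1 ∧ c = t + t⁻¹ := by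
  obtain ⟨t, ht⟩ := IsAlgClosed.exists_root
    (Polynomial.C 1 * Polynomial.X ^ 2 + Polynomial.C (-c) * Polynomial.X + Polynomial.C 1)
    (by rw [Polynomial.degree_quadratic one_ne_zero]; decide)
  have ht : t ^ 2 - c * t + 1 = 0 := by
    have := Polynomial.IsRoot.def.1 ht
    simp at this
    linear_combination this
  have ht0 : t ≠ 0 := by rintro rfl; simp at ht
  have hct : c = t + t⁻¹ := by
    field_simp
    linear_combination -ht
  refine ⟨t, ?_, hct⟩
  rw [hct] at hc
  field_simp at hc
  linear_combination (t - 1) * hc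

theorem map_cubic_root {K : Type*} [Field K] (f : F →+* K) {c : F}
    (hc : c ^ 3 + c ^ 2 - 2 * c - 1 = 0) : f c ^ 3 + f c ^ 2 - 2 * f c - 1 = 0 := by
  simpa [map_ofNat f 2] using congrArg f hc

variable {p : ℕ} [Fact p.Prime] [CharP F p]

theorem pow_eq_self_of_cubic {c : F} (hc : c ^ 3 + c ^ 2 - 2 * c - 1 = 0) {k : ℕ}
    (hk : p ^ k % 7 = 1 ∨ p ^ k % 7 = 6) : c ^ p ^ k = c := by
  let K := AlgebraicClosure F
  have : CharP K p := charP_of_injective_algebraMap (algebraMap F K).injective p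
  obtain ⟨t, ht, hct⟩ := exists_seventh_root_of_cubic (c := algebraMap F K c) (map_cubic_root _ hc)
  have ht0 : t ≠ 0 := by rintro rfl; simp at ht
  apply (algebraMap F K).injective
  rw [map_pow, hct, add_pow_char_pow, inv_pow, pow_eq_pow_mod _ ht]
  rcases hk with h | h <;> rw [h]
  · rw [pow_one]
  · have h6 : t ^ 6 = t⁻¹ := eq_inv_of_mul_eq_one_left (by rw [← pow_succ, ht])
    rw [h6, inv_inv, add_comm]

theorem mod_seven_of_pow_eq_self {c : F} (hc : c ^ 3 + c ^ 2 - 2 * c - 1 = 0) (hp : p ≠ 7)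
    (h : c ^ p = c) : p % 7 = 1 ∨ p % 7 = 6 := by
  let K := AlgebraicClosure F
  have hp0 : p.Prime := Fact.out
  have : CharP K p := charP_of_injective_algebraMap (algebraMap F K).injective p
  have hc' : algebraMap F K c ^ 3 + algebraMap F K c ^ 2 - 2 * algebraMap F K c - 1 = 0 :=
    map_cubic_root _ hc
  obtain ⟨t, ht, hct⟩ := exists_seventh_root_of_cubic hc'
  have ht0 : t ≠ 0 := by rintro rfl; simp at ht
  have h7 : (7 : K) ≠ 0 := by
    intro h7
    have : ((7 : ℕ) : K) = 0 := by exact_mod_cast h7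
    rw [CharP.cast_eq_zero_iff K p] at this
    exact hp ((Nat.prime_dvd_prime_iff_eq hp0 (by norm_num)).1 this)
  have ht1 : t ≠ 1 := by
    rintro rfl
    apply h7
    rw [hct] at hc'
    norm_num at hc'
    linear_combination hc'
  have ho : orderOf t = 7 := by
    have : Fact (Nat.Prime 7) := ⟨by norm_num⟩
    exact orderOf_eq_prime ht ht1
  have e : t ^ p + (t ^ p)⁻¹ = t + t⁻¹ := by
    rw [← inv_pow, ← add_pow_char, ← hct, ← map_pow, h]
  have e' : (t ^ p - t) * (t ^ p - t⁻¹) = 0 := by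
    have hp' : t ^ p ≠ 0 := pow_ne_zero _ ht0
    have h1 : t ^ p * (t ^ p)⁻¹ = 1 := mul_inv_cancel₀ hp'
    have h2 : t * t⁻¹ = 1 := mul_inv_cancel₀ ht0
    linear_combination t ^ p * e - h1 + h2
  have hp1 := hp0.one_lt
  rcases mul_eq_zero.1 e' with h1 | h1
  · left
    have : t ^ (p - 1) = 1 := by
      apply mul_right_cancel₀ ht0
      rw [← pow_succ, Nat.sub_add_cancel hp1.le, one_mul]
      exact sub_eq_zero.1 h1
    have := ho ▸ orderOf_dvd_of_pow_eq_one this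
    omega
  · right
    have : t ^ (p + 1) = 1 := by
      rw [pow_succ, sub_eq_zero.1 h1, inv_mul_cancel₀ ht0]
    have := ho ▸ orderOf_dvd_of_pow_eq_one this
    omega

theorem exists_cubic_root [Finite F] {n : ℕ} (hq : Nat.card F = p ^ n)
    (hmod : p ^ n % 7 = 1 ∨ p ^ n % 7 = 6) : ∃ c : F, c ^ 3 + c ^ 2 - 2 * c - 1 = 0 := by
  let K := AlgebraicClosure F
  have : CharP K p := charP_of_injective_algebraMap (algebraMap F K).injective p
  obtain ⟨d, hd⟩ := IsAlgClosed.exists_root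
    (Polynomial.C 1 * Polynomial.X ^ 3 + Polynomial.C 1 * Polynomial.X ^ 2 +
      Polynomial.C (-2) * Polynomial.X + Polynomial.C (-1) : Polynomial K)
    (by rw [Polynomial.degree_cubic one_ne_zero]; decide)
  have hd : d ^ 3 + d ^ 2 - 2 * d - 1 = 0 := by
    have := Polynomial.IsRoot.def.1 hd
    simp at this
    linear_combination this
  obtain ⟨c, rfl⟩ := mem_range_algebraMap_of_pow_card_eq_self (F := F) (x := d) (by
    rw [hq]
    exact pow_eq_self_of_cubic hd hmod)
  refine ⟨c, (algebraMap F K).injective ?_⟩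
  rw [map_zero, ← hd]
  simp [map_ofNat (algebraMap F K) 2]

theorem eq_two_of_cubic [CharP F 7] {c : F} (hc : c ^ 3 + c ^ 2 - 2 * c - 1 = 0) : c = 2 := by
  have h7 : (7 : F) = 0 := by exact_mod_cast CharP.cast_eq_zero F 7
  have : (c - 2) ^ 3 = 0 := by linear_combination hc + (-c ^ 2 + 2 * c - 1) * h7
  exact sub_eq_zero.1 (pow_eq_zero_iff three_ne_zero |>.1 this)

theorem le_of_pow_eq_self [Finite F] {n k : ℕ} (hq : Nat.card F = p ^ n) {c : F}
    (hgen : ∀ S : Subring F, c ∈ S → S = ⊤) (hk0 : k ≠ 0) (hk : c ^ p ^ k = c) : n ≤ k := by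
  have hp : p.Prime := Fact.out
  have htop := hgen ((iterateFrobenius F p k).eqLocus (RingHom.id F)) (by
    change iterateFrobenius F p k c = c
    rw [iterateFrobenius_def, hk])
  have hall : ∀ a : F, a ^ p ^ k = a := by
    intro a
    have : a ∈ (iterateFrobenius F p k).eqLocus (RingHom.id F) := htop ▸ Subring.mem_top a
    rw [← iterateFrobenius_def]
    exact this
  have := card_le_of_forall_pow_eq_self (Nat.one_lt_pow hk0 hp.one_lt) hall
  rw [hq] at this
  exact (Nat.pow_le_pow_iff_right hp.one_lt).1 this

end FiniteFields

/-- Macbeath's theorem: for a prime power `q = p^n`, the group `PSL(2, q)` is a Hurwitz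
group (an image of the (2,3,7) triangle group) if and only if `q = 7`, or `n = 1` and
`p ≡ ±1 (mod 7)`, or `n = 3` and `p ≡ ±2, ±3 (mod 7)`. -/
theorem psl2q_hurwitz_iff (p n : ℕ) [Fact p.Prime] (hn : 1 ≤ n) :
    (∃ φ : TriangleGroup237 →* PSL(2, GaloisField p n), Function.Surjective φ) ↔
      (p ^ n = 7 ∨
        (n = 1 ∧ (p % 7 = 1 ∨ p % 7 = 6)) ∨
        (n = 3 ∧ (p % 7 = 2 ∨ p % 7 = 3 ∨ p % 7 = 4 ∨ p % 7 = 5))) := by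
  have hp : p.Prime := Fact.out
  have hq : Nat.card (GaloisField p n) = p ^ n := GaloisField.card p n (by omega)
  constructor
  · rintro ⟨φ, hφ⟩
    obtain ⟨c, hc, hgen⟩ := exists_cubic_root_of_surjective hφ
    by_cases hp7 : p = 7
    · subst hp7
      have : n ≤ 1 := le_of_pow_eq_self hq hgen one_ne_zero (by
        rw [eq_two_of_cubic hc, pow_one, ← frobenius_def, map_ofNat])
      obtain rfl : n = 1 := by omega
      left; norm_num
    · right
      have hmod0 : p % 7 ≠ 0 := fun h => hp7
        ((Nat.prime_dvd_prime_iff_eq (by norm_num) hp).1 (Nat.dvd_of_mod_eq_zero h)).symm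
      have hmod1 : p % 7 = 1 ∨ p % 7 = 6 → n = 1 := by
        intro h
        have := le_of_pow_eq_self hq hgen one_ne_zero
          (pow_eq_self_of_cubic hc (by rwa [pow_one]))
        omega
      have h3 : c ^ p ^ 3 = c := pow_eq_self_of_cubic hc (by
        have : p % 7 = 1 ∨ p % 7 = 2 ∨ p % 7 = 3 ∨ p % 7 = 4 ∨ p % 7 = 5 ∨ p % 7 = 6 := by omega
        rw [Nat.pow_mod]
        rcases this with h | h | h | h | h | h <;> simp [h])
      have hn3 := le_of_pow_eq_self hq hgen three_ne_zero h3
      have hpow : c ^ p ^ n = c := by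
        have := Fintype.ofFinite (GaloisField p n)
        rw [← hq, Nat.card_eq_fintype_card, FiniteField.pow_card]
      have hn2 : n ≠ 2 := by
        rintro rfl
        have : c ^ p ^ 1 = c := by
          rw [pow_succ, pow_mul, hpow] at h3
          rwa [pow_one]
        have := le_of_pow_eq_self hq hgen one_ne_zero this
        omega
      by_cases hn1 : n = 1
      · subst hn1
        rw [pow_one] at hpow
        exact Or.inl ⟨rfl, mod_seven_of_pow_eq_self hc hp7 hpow⟩
      · right
        have := mt hmod1 hn1
        omega
  · intro h
    have hpow : ∀ k, k ≤ n → k ≠ 0 → (7 ∣ p ^ k ∨ 7 ∣ p ^ k - 1 ∨ 7 ∣ p ^ k + 1) → k = n := by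
      by_cases hn1 : n = 1
      · intro k; omega
      · have hn3 : n = 3 ∧ (p % 7 = 2 ∨ p % 7 = 3 ∨ p % 7 = 4 ∨ p % 7 = 5) := by
          rcases h with h | h | h
          · exact absurd (Nat.Prime.eq_one_of_pow (x := p) (by rw [h]; norm_num)) hn1
          · exact absurd h.1 hn1
          · exact h
        obtain ⟨rfl, hm⟩ := hn3
        intro k hk hk0 hd
        have hpos : 0 < p ^ k := pow_pos hp.pos k
        have hd' : p ^ k % 7 = 0 ∨ p ^ k % 7 = 1 ∨ p ^ k % 7 = 6 := by omega
        rw [Nat.pow_mod] at hd'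
        have : k = 1 ∨ k = 2 ∨ k = 3 := by omega
        rcases this with rfl | rfl | rfl
        · rcases hm with h | h | h | h <;> simp [h] at hd'
        · rcases hm with h | h | h | h <;> simp [h] at hd'
        · rfl
    obtain ⟨c, hc⟩ : ∃ c : GaloisField p n, c ^ 3 + c ^ 2 - 2 * c - 1 = 0 := by
      rcases h with h | ⟨rfl, h⟩ | ⟨rfl, h⟩
      · have hn1 : n = 1 := Nat.Prime.eq_one_of_pow (x := p) (by rw [h]; norm_num)
        subst hn1
        rw [pow_one] at h
        subst h
        refine ⟨2, ?_⟩
        have h7 : ((7 : ℕ) : GaloisField 7 1) = 0 := CharP.cast_eq_zero _ 7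
        push_cast at h7
        linear_combination h7
      · exact exists_cubic_root hq (by rwa [pow_one])
      · refine exists_cubic_root hq ?_
        rw [Nat.pow_mod]
        rcases h with h | h | h | h <;> simp [h]
    exact exists_surjective_of_cubic_root hp hq hpow hc
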